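/- There exist absolute constants c > 0 and N₀ such that for every integer N ≥ N₀ the following holds: if A ⊆ {1, …, N} contains no nontrivial three-term arithmetic progression, then |A| ≤ exp(−c · (log N)^{1/6} · (log log N)^{−1/6}) · N. -/

import Mathlib

section ThreeTermProgressions

open Finset
open scoped Classical

section Bohr

variable {G : Type*} [AddCommGroup G] [Fintype G]

/-- The Bohr set of points at which every character of `Γ` is within `r` of `1`. -/
noncomputable def bohrSet (Γ : Finset (AddChar G ℂ)) (r : ℝ) : Finset G :=
  {x | ∀ χ ∈ Γ, ‖χ x - 1‖ ≤ r}

variable {Γ Γ' : Finset (AddChar G ℂ)} {r s : ℝ} {x y : G}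

lemma mem_bohrSet : x ∈ bohrSet Γ r ↔ ∀ χ ∈ Γ, ‖χ x - 1‖ ≤ r := by
  simp [bohrSet]

lemma zero_mem_bohrSet (hr : 0 ≤ r) : (0 : G) ∈ bohrSet Γ r := by
  simp [mem_bohrSet, hr]

lemma card_bohrSet_pos (hr : 0 ≤ r) : 0 < #(bohrSet Γ r) :=
  card_pos.2 ⟨0, zero_mem_bohrSet hr⟩

lemma bohrSet_mono (h : r ≤ s) : bohrSet Γ r ⊆ bohrSet Γ s := fun _ hx ↦
  mem_bohrSet.2 fun χ hχ ↦ (mem_bohrSet.1 hx χ hχ).trans h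

lemma bohrSet_anti (h : Γ ⊆ Γ') : bohrSet Γ' r ⊆ bohrSet Γ r := fun _ hx ↦
  mem_bohrSet.2 fun χ hχ ↦ mem_bohrSet.1 hx χ (h hχ)

lemma norm_addChar_sub (χ : AddChar G ℂ) (x y : G) : ‖χ x - χ y‖ = ‖χ (x - y) - 1‖ := by
  have h : χ x - χ y = χ y * (χ (x - y) - 1) := by
    rw [mul_sub, ← AddChar.map_add_eq_mul]; simp
  rw [h, norm_mul, AddChar.norm_apply, one_mul]

lemma add_mem_bohrSet (hx : x ∈ bohrSet Γ r) (hy : y ∈ bohrSet Γ s) :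
    x + y ∈ bohrSet Γ (r + s) := by
  refine mem_bohrSet.2 fun χ hχ ↦ ?_
  have h := norm_sub_le_norm_sub_add_norm_sub (χ (x + y)) (χ y) 1
  rw [norm_addChar_sub, add_sub_cancel_right] at h
  linarith [mem_bohrSet.1 hx χ hχ, mem_bohrSet.1 hy χ hχ]

lemma neg_mem_bohrSet (hx : x ∈ bohrSet Γ r) : -x ∈ bohrSet Γ r := by
  refine mem_bohrSet.2 fun χ hχ ↦ ?_
  have h := norm_addChar_sub χ 0 x
  rw [zero_sub, AddChar.map_zero_eq_one, norm_sub_rev] at h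
  exact h ▸ mem_bohrSet.1 hx χ hχ

lemma sub_mem_bohrSet (hx : x ∈ bohrSet Γ r) (hy : y ∈ bohrSet Γ s) :
    x - y ∈ bohrSet Γ (r + s) := by
  rw [sub_eq_add_neg]; exact add_mem_bohrSet hx (neg_mem_bohrSet hy)

lemma bohrSet_two : bohrSet Γ 2 = univ := by
  refine eq_univ_of_forall fun x ↦ mem_bohrSet.2 fun χ _ ↦ (norm_sub_le _ _).trans ?_
  rw [AddChar.norm_apply, norm_one]; norm_num

lemma floor_cell_lt {a r : ℝ} (hr : 0 < r) (ha : |a| ≤ r) : ⌊(a + r) / (r / 4)⌋₊ < 9 := by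
  rw [Nat.floor_lt (by have := abs_le.1 ha; exact div_nonneg (by linarith) (by linarith)),
    div_lt_iff₀ (by linarith)]
  have := abs_le.1 ha
  push_cast; linarith

lemma abs_sub_le_of_floor_eq {a b r : ℝ} (hr : 0 < r) (ha : |a| ≤ r) (hb : |b| ≤ r)
    (h : ⌊(a + r) / (r / 4)⌋₊ = ⌊(b + r) / (r / 4)⌋₊) : |a - b| ≤ r / 4 := by
  have hr4 : 0 < r / 4 := by linarith
  have key : ∀ {a b : ℝ}, |a| ≤ r → |b| ≤ r →
      ⌊(a + r) / (r / 4)⌋₊ = ⌊(b + r) / (r / 4)⌋₊ → a - b ≤ r / 4 := by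
    intro a b ha hb h
    have h1 := Nat.lt_floor_add_one ((a + r) / (r / 4))
    have h2 := Nat.floor_le (a := (b + r) / (r / 4))
      (div_nonneg (by linarith [abs_le.1 hb]) hr4.le)
    rw [h] at h1
    rw [div_lt_iff₀ hr4] at h1
    rw [le_div_iff₀ hr4] at h2
    linarith
  exact abs_le.2 ⟨by linarith [key hb ha h.symm], key ha hb h⟩

/-- Halving the radius of a Bohr set costs at most a factor exponential in the rank. -/
lemma card_bohrSet_le_half (hr : 0 < r) :
    #(bohrSet Γ r) ≤ 81 ^ #Γ * #(bohrSet Γ (r / 2)) := by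
  have habs : ∀ {x}, x ∈ bohrSet Γ r → ∀ χ ∈ Γ, |(χ x - 1).re| ≤ r ∧ |(χ x - 1).im| ≤ r :=
    fun hx χ hχ ↦ ⟨(Complex.abs_re_le_norm _).trans (mem_bohrSet.1 hx χ hχ),
      (Complex.abs_im_le_norm _).trans (mem_bohrSet.1 hx χ hχ)⟩
  set f : G → (Γ → Fin 9 × Fin 9) := fun x χ ↦
    (Fin.ofNat 9 ⌊((χ.1 x - 1).re + r) / (r / 4)⌋₊, Fin.ofNat 9 ⌊((χ.1 x - 1).im + r) / (r / 4)⌋₊)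
    with hf
  have hfib : ∀ a ∈ (bohrSet Γ r).image f,
      #{x ∈ bohrSet Γ r | f x = a} ≤ #(bohrSet Γ (r / 2)) := by
    intro a ha
    obtain ⟨x₀, hx₀, rfl⟩ := mem_image.1 ha
    refine card_le_card_of_injOn (fun x ↦ x - x₀) ?_ (fun x _ y _ h ↦ sub_left_injective h)
    intro x hx
    obtain ⟨hx, hxa⟩ := mem_filter.1 hx
    refine mem_bohrSet.2 fun χ hχ ↦ ?_
    rw [← norm_addChar_sub]
    have h := congrFun hxa ⟨χ, hχ⟩
    simp only [hf, Prod.mk.injEq, Fin.ext_iff, Fin.ofNat] at h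
    obtain ⟨h1, h2⟩ := h
    obtain ⟨hx1, hx2⟩ := habs hx χ hχ
    obtain ⟨hy1, hy2⟩ := habs hx₀ χ hχ
    rw [Nat.mod_eq_of_lt (floor_cell_lt hr hx1), Nat.mod_eq_of_lt (floor_cell_lt hr hy1)] at h1
    rw [Nat.mod_eq_of_lt (floor_cell_lt hr hx2), Nat.mod_eq_of_lt (floor_cell_lt hr hy2)] at h2
    have e1 := abs_sub_le_of_floor_eq hr hx1 hy1 h1
    have e2 := abs_sub_le_of_floor_eq hr hx2 hy2 h2
    have h3 := Complex.norm_le_abs_re_add_abs_im (χ x - χ x₀)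
    simp only [Complex.sub_re, Complex.sub_im, sub_sub_sub_cancel_right] at h3 e1 e2
    linarith
  have h := card_le_mul_card_image (bohrSet Γ r) _ hfib
  have h2 : #((bohrSet Γ r).image f) ≤ 81 ^ #Γ := by
    refine (card_le_univ _).trans_eq ?_
    simp
  calc _ ≤ _ := h
    _ ≤ #(bohrSet Γ (r / 2)) * 81 ^ #Γ := Nat.mul_le_mul_left _ h2
    _ = _ := mul_comm _ _

lemma card_le_card_bohrSet (k : ℕ) :
    Fintype.card G ≤ 81 ^ (#Γ * k) * #(bohrSet Γ (2 / 2 ^ k)) := by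
  induction k with
  | zero => simp [bohrSet_two]
  | succ k ih =>
    refine ih.trans ?_
    rw [mul_add, pow_add, mul_one, mul_assoc]
    refine Nat.mul_le_mul_left _ ?_
    have h := card_bohrSet_le_half (Γ := Γ) (r := 2 / 2 ^ k) (by positivity)
    rwa [div_div, ← pow_succ] at h

/-- The growth condition that plays the role of regularity for a Bohr set of rank at most `d`. -/
def BohrRegular (d : ℕ) (Γ : Finset (AddChar G ℂ)) (r : ℝ) : Prop :=
  (#(bohrSet Γ ((1 + 1 / (1000 * d)) * r)) : ℝ) ≤ 1.01 * #(bohrSet Γ r)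

lemma exists_bohrRegular {d : ℕ} (hd : 1 ≤ d) (hΓ : #Γ ≤ d) {r₀ : ℝ} (hr : 0 < r₀) :
    ∃ r, r₀ / 2 ≤ r ∧ r ≤ r₀ ∧ BohrRegular d Γ r := by
  by_contra! hcon
  have hd' : (1 : ℝ) ≤ d := by exact_mod_cast hd
  set κ : ℝ := 1 / (1000 * d) with hκ
  have hκ0 : 0 < κ := by positivity
  have hJ : (1 + κ) ^ (500 * d) ≤ 2 := by
    have h1 : (1 + κ) ^ (500 * d) ≤ Real.exp κ ^ (500 * d) :=
      pow_le_pow_left₀ (by positivity) (by linarith [Real.add_one_le_exp κ]) _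
    rw [← Real.exp_nat_mul] at h1
    have h2 : ((500 * d : ℕ) : ℝ) * κ = 1 / 2 := by
      rw [hκ]; push_cast; field_simp; norm_num
    rw [h2] at h1
    refine h1.trans ?_
    have h3 : Real.exp (1 / 2) ^ 2 ≤ 4 := by
      rw [← Real.exp_nat_mul]; norm_num
      linarith [Real.exp_one_lt_d9]
    nlinarith [Real.exp_pos (1 / 2)]
  have hmain : ∀ j ≤ 500 * d, (1.01 : ℝ) ^ j * #(bohrSet Γ (r₀ / 2)) ≤
      #(bohrSet Γ ((1 + κ) ^ j * (r₀ / 2))) := by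
    intro j hj
    induction j with
    | zero => simp
    | succ j ih =>
      have h1 : (1 + κ) ^ j ≤ 2 :=
        (pow_le_pow_right₀ (by linarith) (by omega)).trans hJ
      have h0 : 1 ≤ (1 + κ) ^ j := one_le_pow₀ (by linarith)
      have h2 := hcon ((1 + κ) ^ j * (r₀ / 2)) (by nlinarith) (by nlinarith)
      rw [BohrRegular, not_le, ← hκ, ← mul_assoc, ← pow_succ'] at h2
      have h3 := ih (by omega)
      rw [pow_succ' (1.01 : ℝ), mul_assoc]
      linarith
  have h1 := hmain (500 * d) le_rfl
  have h2 : (#(bohrSet Γ ((1 + κ) ^ (500 * d) * (r₀ / 2))) : ℝ) ≤ #(bohrSet Γ r₀) := by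
    exact_mod_cast card_le_card (bohrSet_mono (by nlinarith))
  have h3 : (#(bohrSet Γ r₀) : ℝ) ≤ 81 ^ d * #(bohrSet Γ (r₀ / 2)) := by
    have := card_bohrSet_le_half (Γ := Γ) hr
    have h4 : 81 ^ #Γ * #(bohrSet Γ (r₀ / 2)) ≤ 81 ^ d * #(bohrSet Γ (r₀ / 2)) :=
      Nat.mul_le_mul_right _ (Nat.pow_le_pow_right (by norm_num) hΓ)
    exact_mod_cast this.trans h4
  have hpos : (0 : ℝ) < #(bohrSet Γ (r₀ / 2)) := by
    exact_mod_cast card_bohrSet_pos (by linarith)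
  have h5 : (1.01 : ℝ) ^ (500 * d) ≤ 81 ^ d :=
    le_of_mul_le_mul_right (h1.trans (h2.trans h3)) hpos
  have h6 : (81 : ℝ) ^ d < ((1.01 : ℝ) ^ 500) ^ d :=
    pow_lt_pow_left₀ (by rw [show 500 = 250 * 2 from rfl, pow_mul]; norm_num) (by norm_num)
      (by omega)
  rw [pow_mul] at h5
  exact h6.not_ge h5

end Bohr

section Sampling

variable {ι κ : Type*} [Fintype ι]

lemma exp_mul_le_cosh_add_mul_sinh {t z : ℝ} (hz : |z| ≤ 1) :
    Real.exp (t * z) ≤ Real.cosh t + z * Real.sinh t := by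
  obtain ⟨h1, h2⟩ := abs_le.1 hz
  have h := convexOn_exp.2 (Set.mem_univ (-t)) (Set.mem_univ t)
    (show 0 ≤ (1 - z) / 2 by linarith) (show 0 ≤ (1 + z) / 2 by linarith) (by ring)
  rw [Real.cosh_eq, Real.sinh_eq]
  calc Real.exp (t * z) = Real.exp (((1 - z) / 2) • -t + ((1 + z) / 2) • t) := by
        congr 1; simp only [smul_eq_mul]; ring
    _ ≤ _ := h
    _ = _ := by simp only [smul_eq_mul]; ring

/-- Hoeffding's inequality for a finitely supported distribution. -/
lemma sum_prod_mul_ite_le {w z : ι → ℝ} (hw : ∀ i, 0 ≤ w i) (hw1 : ∑ i, w i = 1)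
    (hz : ∀ i, |z i| ≤ 1) (hwz : ∑ i, w i * z i = 0) (m : ℕ) (t : ℝ) (ht : 0 ≤ t) :
    ∑ a : Fin m → ι, (∏ i, w (a i)) * (if t * m ≤ ∑ i, z (a i) then 1 else 0) ≤
      Real.exp (-(t ^ 2 * m / 2)) := by
  have h1 : ∀ a : Fin m → ι, (∏ i, w (a i)) * (if t * m ≤ ∑ i, z (a i) then 1 else 0) ≤
      Real.exp (-(t ^ 2 * m)) * ∏ i, (w (a i) * Real.exp (t * z (a i))) := by
    intro a
    rw [prod_mul_distrib, ← Real.exp_sum, mul_left_comm, ← Real.exp_add, ← mul_sum]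
    refine mul_le_mul_of_nonneg_left ?_ (prod_nonneg fun i _ ↦ hw _)
    split_ifs with h
    · exact Real.one_le_exp (by nlinarith)
    · exact (Real.exp_pos _).le
  have h2 : ∑ i, w i * Real.exp (t * z i) ≤ Real.exp (t ^ 2 / 2) := by
    calc _ ≤ ∑ i, (w i * Real.cosh t + w i * z i * Real.sinh t) := by
          refine sum_le_sum fun i _ ↦ ?_
          have := mul_le_mul_of_nonneg_left (exp_mul_le_cosh_add_mul_sinh (t := t) (hz i)) (hw i)
          linarith
      _ = Real.cosh t := by rw [sum_add_distrib, ← sum_mul, ← sum_mul, hw1, hwz]; ring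
      _ ≤ _ := Real.cosh_le_exp_half_sq t
  calc _ ≤ ∑ a : Fin m → ι, Real.exp (-(t ^ 2 * m)) * ∏ i, (w (a i) * Real.exp (t * z (a i))) :=
        sum_le_sum fun a _ ↦ h1 a
    _ = Real.exp (-(t ^ 2 * m)) * (∑ i, w i * Real.exp (t * z i)) ^ m := by
        rw [← mul_sum, Fintype.sum_pow]
    _ ≤ Real.exp (-(t ^ 2 * m)) * Real.exp (t ^ 2 / 2) ^ m := by
        gcongr
        exact sum_nonneg fun i _ ↦ mul_nonneg (hw i) (Real.exp_pos _).le
    _ = _ := by rw [← Real.exp_nat_mul, ← Real.exp_add]; congr 1; ring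

/-- The expected number of points at which an empirical average of `m` samples deviates from the
true average by more than `η`. -/
lemma sum_prod_mul_card_deviation_le {w : ι → ℝ} (hw : ∀ i, 0 ≤ w i) (hw1 : ∑ i, w i = 1)
    (S : Finset κ) {z : κ → ι → ℝ} (hz : ∀ x i, |z x i| ≤ 1) {m : ℕ} (hm : 0 < m) {η : ℝ}
    (hη : 0 ≤ η) :
    ∑ a : Fin m → ι, (∏ i, w (a i)) *
        (#{x ∈ S | η < |(∑ i, z x (a i)) / m - ∑ j, w j * z x j|} : ℝ) ≤
      2 * #S * Real.exp (-(η ^ 2 * m / 8)) := by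
  have hm' : (0 : ℝ) < m := by exact_mod_cast hm
  set g : κ → ℝ := fun x ↦ ∑ j, w j * z x j with hg
  have hg1 : ∀ x, |g x| ≤ 1 := by
    intro x
    refine (abs_sum_le_sum_abs _ _).trans ?_
    rw [← hw1]
    refine sum_le_sum fun i _ ↦ ?_
    rw [abs_mul, abs_of_nonneg (hw i)]
    exact mul_le_of_le_one_right (hw i) (hz x i)
  have key : ∀ x, ∑ a : Fin m → ι, (∏ i, w (a i)) *
      (if η < |(∑ i, z x (a i)) / m - g x| then (1 : ℝ) else 0) ≤
        2 * Real.exp (-(η ^ 2 * m / 8)) := by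
    intro x
    have hb : ∀ i, |(z x i - g x) / 2| ≤ 1 := by
      intro i
      have h1 := abs_le.1 (hz x i)
      have h2 := abs_le.1 (hg1 x)
      exact abs_le.2 ⟨by linarith, by linarith⟩
    have hs : ∑ i, w i * ((z x i - g x) / 2) = 0 := by
      have : ∀ i, w i * ((z x i - g x) / 2) = (w i * z x i - w i * g x) / 2 := fun i ↦ by ring
      simp_rw [this]
      rw [← sum_div, sum_sub_distrib, ← sum_mul, hw1]
      simp [hg]
    have hs' : ∑ i, w i * -((z x i - g x) / 2) = 0 := by
      simp_rw [mul_neg]; rw [sum_neg_distrib, hs, neg_zero]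
    have e1 := sum_prod_mul_ite_le hw hw1 hb hs m (η / 2) (by linarith)
    have e2 := sum_prod_mul_ite_le hw hw1 (z := fun i ↦ -((z x i - g x) / 2))
      (fun i ↦ by rw [abs_neg]; exact hb i) hs' m (η / 2) (by linarith)
    have e3 : (η / 2) ^ 2 * m / 2 = η ^ 2 * m / 8 := by ring
    rw [e3] at e1 e2
    rw [two_mul]
    refine le_trans ?_ (add_le_add e1 e2)
    rw [← sum_add_distrib]
    refine sum_le_sum fun a _ ↦ ?_
    rw [← mul_add]
    refine mul_le_mul_of_nonneg_left ?_ (prod_nonneg fun i _ ↦ hw _)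
    have hsum : ∑ i, (z x (a i) - g x) / 2 = ((∑ i, z x (a i)) / m - g x) / 2 * m := by
      rw [← sum_div, sum_sub_distrib]; simp; field_simp
    rw [sum_neg_distrib, hsum]
    split_ifs with h1 h2 h3 h3 <;> try norm_num
    · rcases lt_abs.1 h1 with h | h
      · exact h2 (by gcongr)
      · apply h3; rw [← neg_mul, ← neg_div]; gcongr
  calc _ = ∑ x ∈ S, ∑ a : Fin m → ι, (∏ i, w (a i)) *
      (if η < |(∑ i, z x (a i)) / m - g x| then (1 : ℝ) else 0) := by
        rw [sum_comm]
        refine sum_congr rfl fun a _ ↦ ?_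
        rw [← mul_sum, sum_boole]
    _ ≤ ∑ x ∈ S, 2 * Real.exp (-(η ^ 2 * m / 8)) := sum_le_sum fun x _ ↦ key x
    _ = _ := by rw [sum_const, nsmul_eq_mul]; ring

end Sampling

section Unbalancing

variable {G : Type*}

/-- The real-valued indicator function of a finite set. -/
noncomputable def ind (A : Finset G) (x : G) : ℝ := if x ∈ A then 1 else 0

lemma ind_nonneg (A : Finset G) (x : G) : 0 ≤ ind A x := by rw [ind]; split_ifs <;> norm_num

lemma ind_le_one (A : Finset G) (x : G) : ind A x ≤ 1 := by rw [ind]; split_ifs <;> norm_num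

lemma ind_of_mem {A : Finset G} {x : G} (h : x ∈ A) : ind A x = 1 := if_pos h

variable [Fintype G]

lemma sum_ind (A : Finset G) : ∑ x, ind A x = #A := by simp [ind]

lemma sum_mul_ind (f : G → ℝ) (A : Finset G) : ∑ x, f x * ind A x = ∑ x ∈ A, f x := by
  simp [ind, sum_ite_mem]

variable [AddCommGroup G]

/-- The autocorrelation of a real function on a finite abelian group. -/
noncomputable def corr (f : G → ℝ) (x : G) : ℝ := ∑ s, f (x + s) * f s

lemma corr_sub (f : G → ℝ) (x y : G) : corr f (x - y) = ∑ s, f (x + s) * f (y + s) :=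
  Fintype.sum_equiv (Equiv.subRight y) _ _ fun s ↦ by
    simp only [Equiv.subRight_apply, add_sub_cancel]; congr 2; abel

lemma corr_ind_nonneg (A : Finset G) (x : G) : 0 ≤ corr (ind A) x :=
  sum_nonneg fun _ _ ↦ mul_nonneg (ind_nonneg _ _) (ind_nonneg _ _)

lemma corr_ind_le (A : Finset G) (x : G) : corr (ind A) x ≤ #A := by
  rw [← sum_ind]
  exact sum_le_sum fun s _ ↦ mul_le_of_le_one_left (ind_nonneg _ _) (ind_le_one _ _)

lemma sum_mul_sum_pow {κ κ' ι : Type*} [Fintype ι] (D : Finset κ) (E : Finset κ')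
    (ψ : κ → κ' → ℝ) (f : κ → ι → ℝ) (g : κ' → ι → ℝ) (k : ℕ) :
    ∑ x ∈ D, ∑ y ∈ E, ψ x y * (∑ s, f x s * g y s) ^ k =
      ∑ s : Fin k → ι, ∑ x ∈ D, ∑ y ∈ E, ψ x y * ((∏ i, f x (s i)) * ∏ i, g y (s i)) := by
  symm
  rw [sum_comm]
  refine sum_congr rfl fun x _ ↦ ?_
  rw [sum_comm]
  refine sum_congr rfl fun y _ ↦ ?_
  simp_rw [Fintype.sum_pow, mul_sum, prod_mul_distrib]

lemma sum_sum_pow {κ κ' ι : Type*} [Fintype ι] (D : Finset κ) (E : Finset κ')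
    (f : κ → ι → ℝ) (g : κ' → ι → ℝ) (k : ℕ) :
    ∑ x ∈ D, ∑ y ∈ E, (∑ s, f x s * g y s) ^ k =
      ∑ s : Fin k → ι, (∑ x ∈ D, ∏ i, f x (s i)) * ∑ y ∈ E, ∏ i, g y (s i) := by
  have := sum_mul_sum_pow D E (fun _ _ ↦ 1) f g k
  simpa only [one_mul, ← sum_mul_sum] using this

lemma sum_corr_pow_eq (f : G → ℝ) (D : Finset G) (k : ℕ) :
    ∑ x ∈ D, ∑ y ∈ D, corr f (x - y) ^ k =
      ∑ s : Fin k → G, (∑ x ∈ D, ∏ i, f (x + s i)) ^ 2 := by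
  simp_rw [corr_sub, sq]
  exact sum_sum_pow D D (fun x s ↦ f (x + s)) (fun x s ↦ f (x + s)) k

lemma sum_corr_pow_nonneg (f : G → ℝ) (D : Finset G) (k : ℕ) :
    0 ≤ ∑ x ∈ D, ∑ y ∈ D, corr f (x - y) ^ k := by
  rw [sum_corr_pow_eq]; exact sum_nonneg fun _ _ ↦ sq_nonneg _

/-- Moments of a shifted self-convolution are dominated by those of the autocorrelation. -/
lemma sum_conv_pow_le (f : G → ℝ) (D : Finset G) (c : G) (k : ℕ) :
    ∑ x ∈ D, ∑ y ∈ D, (∑ s, f s * f (c + x - y - s)) ^ k ≤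
      ∑ x ∈ D, ∑ y ∈ D, corr f (x - y) ^ k := by
  have h1 : ∀ x y, ∑ s, f s * f (c + x - y - s) = ∑ s, f (x + s) * f (c - y - s) := fun x y ↦
    (Fintype.sum_equiv (Equiv.addLeft x) _ _ fun s ↦ by
      simp only [Equiv.coe_addLeft]; congr 2; abel).symm
  have h2 : ∑ x ∈ D, ∑ y ∈ D, corr f (x - y) ^ k =
      ∑ s : Fin k → G, (∑ y ∈ D, ∏ i, f (c - y - s i)) ^ 2 := by
    have h3 : ∀ x y, corr f (x - y) = ∑ s, f (c - x - s) * f (c - y - s) := by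
      intro x y
      refine Fintype.sum_equiv (Equiv.subLeft (c - x)) _ _ fun s ↦ ?_
      simp only [Equiv.subLeft_apply, sub_sub_cancel, mul_comm (f s)]
      congr 2; abel
    simp_rw [h3, sq]
    exact sum_sum_pow D D (fun x s ↦ f (c - x - s)) (fun x s ↦ f (c - x - s)) k
  simp_rw [h1]
  rw [sum_sum_pow D D (fun x s ↦ f (x + s)) (fun y s ↦ f (c - y - s)) k]
  have h4 := sum_corr_pow_eq f D k
  have h5 : 2 * ∑ s : Fin k → G, (∑ x ∈ D, ∏ i, f (x + s i)) * (∑ y ∈ D, ∏ i, f (c - y - s i)) ≤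
      ∑ s : Fin k → G, (∑ x ∈ D, ∏ i, f (x + s i)) ^ 2 +
        ∑ s : Fin k → G, (∑ y ∈ D, ∏ i, f (c - y - s i)) ^ 2 := by
    rw [mul_sum, ← sum_add_distrib]
    refine sum_le_sum fun s _ ↦ ?_
    rw [← mul_assoc]; exact two_mul_le_add_sq _ _
  linarith

lemma four_pow_le_choose {p : ℕ} (hp : 0 < p) : (4 : ℝ) ^ p ≤ (5 * p + 1).choose p := by
  refine le_trans ?_ (Nat.pow_le_choose p (5 * p + 1))
  rw [le_div_iff₀ (by positivity)]
  have h1 : (p.factorial : ℝ) ≤ p ^ p := by exact_mod_cast Nat.factorial_le_pow p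
  have h2 : ((5 * p + 1 + 1 - p : ℕ) : ℝ) = 4 * p + 2 := by
    rw [show 5 * p + 1 + 1 - p = 4 * p + 2 by omega]; push_cast; ring
  rw [h2]
  calc (4 : ℝ) ^ p * p.factorial ≤ 4 ^ p * p ^ p := by gcongr
    _ = (4 * p) ^ p := by rw [mul_pow]
    _ ≤ _ := by gcongr; linarith

/-- A large even moment of a function all of whose moments are nonnegative forces a large odd
moment of any majorant of its translate by one. -/
lemma sum_pow_ge_of_moments {κ : Type*} (S : Finset κ) {u F : κ → ℝ}
    (hu : ∀ k : ℕ, 0 ≤ ∑ x ∈ S, u x ^ k) (hF : ∀ x ∈ S, 1 + u x ≤ F x) {p : ℕ} (hp : 0 < p)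
    (hpe : Even p) : 4 ^ p * ∑ x ∈ S, u x ^ p ≤ ∑ x ∈ S, F x ^ (5 * p + 1) := by
  have hodd : Odd (5 * p + 1) := (hpe.mul_left 5).add_one
  calc (4 : ℝ) ^ p * ∑ x ∈ S, u x ^ p
      ≤ (5 * p + 1).choose p * ∑ x ∈ S, u x ^ p :=
        mul_le_mul_of_nonneg_right (four_pow_le_choose hp) (hu p)
    _ ≤ ∑ k ∈ range (5 * p + 1 + 1), (5 * p + 1).choose k * ∑ x ∈ S, u x ^ k :=
        single_le_sum (f := fun k ↦ ((5 * p + 1).choose k : ℝ) * ∑ x ∈ S, u x ^ k)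
          (fun k _ ↦ mul_nonneg (by positivity) (hu k)) (by simp; omega)
    _ = ∑ x ∈ S, (1 + u x) ^ (5 * p + 1) := by
        simp_rw [add_comm (1 : ℝ), add_pow, mul_sum]
        rw [sum_comm]
        exact sum_congr rfl fun x _ ↦ sum_congr rfl fun k _ ↦ by rw [one_pow]; ring
    _ ≤ _ := sum_le_sum fun x hx ↦ hodd.strictMono_pow.monotone (hF x hx)

end Unbalancing

section DensityMoments

variable {G : Type*} [Fintype G]

lemma sum_balanced_mul (A B : Finset G) (e : G ≃ G) (c : ℝ) :
    ∑ s, (c * ind A (e s) - ind B (e s)) * (c * ind A s - ind B s) =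
      c ^ 2 * ∑ s, ind A (e s) * ind A s - c * ∑ s ∈ A, ind B (e.symm s) -
        c * ∑ s ∈ A, ind B (e s) + ∑ s, ind B (e s) * ind B s := by
  have h1 : ∑ s ∈ A, ind B (e.symm s) = ∑ s, ind A (e s) * ind B s := by
    rw [← sum_mul_ind]
    refine (Fintype.sum_equiv e _ _ fun s ↦ ?_).symm
    rw [e.symm_apply_apply, mul_comm]
  rw [h1, ← sum_mul_ind (fun s ↦ ind B (e s)), mul_sum, mul_sum, mul_sum, ← sum_sub_distrib,
    ← sum_sub_distrib, ← sum_add_distrib]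
  exact sum_congr rfl fun s _ ↦ by ring

lemma sum_balanced_mul_le (A B : Finset G) (hA : 0 < #A) (e : G ≃ G)
    (h1 : ∀ s ∈ A, e s ∈ B) (h2 : ∀ s ∈ A, e.symm s ∈ B) :
    ∑ s, ((#B / #A : ℝ) * ind A (e s) - ind B (e s)) * ((#B / #A : ℝ) * ind A s - ind B s) ≤
      (#B / #A : ℝ) ^ 2 * ∑ s, ind A (e s) * ind A s - #B := by
  have hA' : (0 : ℝ) < #A := by exact_mod_cast hA
  have e1 : ∑ s ∈ A, ind B (e s) = #A := by
    rw [sum_congr rfl fun s hs ↦ ind_of_mem (h1 s hs)]; simp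
  have e2 : ∑ s ∈ A, ind B (e.symm s) = #A := by
    rw [sum_congr rfl fun s hs ↦ ind_of_mem (h2 s hs)]; simp
  have e3 : ∑ s, ind B (e s) * ind B s ≤ #B := by
    rw [← sum_ind]
    exact sum_le_sum fun s _ ↦ mul_le_of_le_one_left (ind_nonneg _ _) (ind_le_one _ _)
  rw [sum_balanced_mul, e1, e2, div_mul_cancel₀ _ hA'.ne']
  linarith

variable [AddCommGroup G]

/-- A set with few representations of the elements of `C` as a sum of two of its elements has
an autocorrelation with a large high moment on `D - D`. -/
lemma sum_corr_pow_ge {A B C D Y : Finset G} {l : ℕ} (hA : 0 < #A)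
    (hD : ∀ x ∈ D, ∀ y ∈ D, ∀ a ∈ A, a + x - y ∈ B) (hC : ∀ c ∈ C, ∀ a ∈ A, c - a ∈ B)
    (hrep : ∀ c ∈ C, #{a ∈ A | c - a ∈ A} ≤ 1) (hAB : 4 * #B ≤ #A ^ 2) (hB : 0 < #B)
    (hY : ∀ c ∈ C, ∀ x ∈ D, ∀ y ∈ D, c + x - y ∈ Y) (hYC : #Y ≤ 2 ^ (l + 1) * #C)
    (hC0 : 0 < #C) :
    2 ^ (2 * (l + 1)) * (#D : ℝ) ^ 2 * ((#A : ℝ) ^ 2 / #B) ^ (5 * (2 * (l + 1)) + 1) ≤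
      ∑ x ∈ D, ∑ y ∈ D, corr (ind A) (x - y) ^ (5 * (2 * (l + 1)) + 1) := by
  set p := 2 * (l + 1) with hp
  have hp0 : 0 < p := by omega
  have hpe : Even p := even_two_mul _
  have hA' : (0 : ℝ) < #A := by exact_mod_cast hA
  have hB' : (0 : ℝ) < #B := by exact_mod_cast hB
  have hC' : (0 : ℝ) < #C := by exact_mod_cast hC0
  have hAB' : 4 * (#B : ℝ) ≤ (#A : ℝ) ^ 2 := by exact_mod_cast hAB
  have hYC' : (#Y : ℝ) ≤ 2 ^ (l + 1) * #C := by exact_mod_cast hYC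
  set f : G → ℝ := fun s ↦ (#B / #A : ℝ) * ind A s - ind B s with hf
  have hu : ∀ x ∈ D, ∀ y ∈ D, 1 + corr f (x - y) / #B ≤ #B / #A ^ 2 * corr (ind A) (x - y) := by
    intro x hx y hy
    have h := sum_balanced_mul_le A B hA (Equiv.addLeft (x - y))
      (fun s hs ↦ by
        have := hD x hx y hy s hs
        simpa [sub_add_eq_add_sub, add_comm x s] using this)
      (fun s hs ↦ by
        rw [show (Equiv.addLeft (x - y)).symm s = s + y - x by
          rw [Equiv.symm_apply_eq]; change s = x - y + (s + y - x); abel]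
        exact hD y hy x hx s hs)
    simp only [Equiv.coe_addLeft] at h
    change corr f (x - y) ≤ (#B / #A : ℝ) ^ 2 * corr (ind A) (x - y) - #B at h
    have h' := div_le_div_of_nonneg_right h hB'.le
    have h2 : ((#B / #A : ℝ) ^ 2 * corr (ind A) (x - y) - #B) / #B =
      #B / #A ^ 2 * corr (ind A) (x - y) - 1 := by field_simp
    linarith
  have hv : ∀ c ∈ C, (3 / 4 * #B : ℝ) ^ p ≤ (∑ s, f s * f (c - s)) ^ p := by
    intro c hc
    have h := sum_balanced_mul_le A B hA (Equiv.subLeft c)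
      (fun s hs ↦ hC c hc s hs) (fun s hs ↦ by simpa [sub_eq_neg_add] using hC c hc s hs)
    simp only [Equiv.subLeft_apply] at h
    have h1 : ∑ s, ind A (c - s) * ind A s ≤ 1 := by
      rw [sum_mul_ind]
      simp only [ind, sum_boole]
      exact_mod_cast hrep c hc
    have h2 : (#B / #A : ℝ) ^ 2 ≤ #B / 4 := by
      rw [div_pow, div_le_div_iff₀ (by positivity) (by norm_num)]
      nlinarith
    have h3 : (#B / #A : ℝ) ^ 2 * ∑ s, ind A (c - s) * ind A s ≤ #B / 4 :=
      (mul_le_of_le_one_right (by positivity) h1).trans h2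
    have h4 : ∑ s, f s * f (c - s) ≤ - (3 / 4 * #B) := by
      rw [sum_congr rfl fun s _ ↦ mul_comm (f s) (f (c - s))]
      simp only [hf]
      linarith
    rw [← hpe.neg_pow (∑ s, f s * f (c - s))]
    exact pow_le_pow_left₀ (by positivity) (by linarith) _
  have hsum : (#C : ℝ) * #D ^ 2 * (3 / 4 * #B : ℝ) ^ p ≤
      #Y * ∑ x ∈ D, ∑ y ∈ D, corr f (x - y) ^ p := by
    calc (#C : ℝ) * #D ^ 2 * (3 / 4 * #B : ℝ) ^ p
        = ∑ x ∈ D, ∑ y ∈ D, ∑ c ∈ C, (3 / 4 * #B : ℝ) ^ p := by simp; ring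
      _ ≤ ∑ x ∈ D, ∑ y ∈ D, ∑ c ∈ Y, (∑ s, f s * f (c + x - y - s)) ^ p := by
          refine sum_le_sum fun x hx ↦ sum_le_sum fun y hy ↦ ?_
          have : ∀ c ∈ C, (∑ s, f s * f (c - s)) ^ p =
              (∑ s, f s * f ((c + y - x) + x - y - s)) ^ p := by
            intro c _
            congr 1
            refine sum_congr rfl fun s _ ↦ ?_
            rw [show c + y - x + x - y = c by abel]
          refine (sum_le_sum hv).trans ?_
          rw [sum_congr rfl this, ← sum_image (s := C) (g := fun c ↦ c + y - x)
            (f := fun c ↦ (∑ s, f s * f (c + x - y - s)) ^ p)]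
          · refine sum_le_sum_of_subset_of_nonneg ?_ fun _ _ _ ↦ hpe.pow_nonneg _
            exact image_subset_iff.2 fun c hc ↦ hY c hc y hy x hx
          · intro a _ b _ h; simpa using h
      _ = ∑ c ∈ Y, ∑ x ∈ D, ∑ y ∈ D, (∑ s, f s * f (c + x - y - s)) ^ p :=
          (sum_congr rfl fun x _ ↦ sum_comm).trans sum_comm
      _ ≤ ∑ c ∈ Y, ∑ x ∈ D, ∑ y ∈ D, corr f (x - y) ^ p :=
          sum_le_sum fun c _ ↦ sum_conv_pow_le f D c p
      _ = _ := by simp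
  have hmom := sum_pow_ge_of_moments (D ×ˢ D) (u := fun z ↦ corr f (z.1 - z.2) / #B)
    (F := fun z ↦ #B / #A ^ 2 * corr (ind A) (z.1 - z.2))
    (fun k ↦ by
      simp_rw [div_pow, ← sum_div, sum_product]
      exact div_nonneg (sum_corr_pow_nonneg f D k) (by positivity))
    (fun z hz ↦ hu _ (mem_product.1 hz).1 _ (mem_product.1 hz).2) hp0 hpe
  simp_rw [sum_product, div_pow, mul_pow, ← sum_div, ← mul_sum] at hmom
  set U := ∑ x ∈ D, ∑ y ∈ D, corr f (x - y) ^ p with hU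
  set V := ∑ x ∈ D, ∑ y ∈ D, corr (ind A) (x - y) ^ (5 * p + 1) with hV
  have hU0 : 0 ≤ U := sum_corr_pow_nonneg f D p
  have h1 : (#D : ℝ) ^ 2 * (3 / 4 * #B : ℝ) ^ p ≤ 2 ^ (l + 1) * U := by
    refine le_of_mul_le_mul_left ?_ hC'
    calc _ = (#C : ℝ) * #D ^ 2 * (3 / 4 * #B : ℝ) ^ p := by ring
      _ ≤ #Y * U := hsum
      _ ≤ 2 ^ (l + 1) * #C * U := by gcongr
      _ = _ := by ring
  have h2 : (2 : ℝ) ^ p * #D ^ 2 ≤ 4 ^ p * (U / #B ^ p) := by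
    have h3 : (#D : ℝ) ^ 2 * (3 / 4) ^ p ≤ 2 ^ (l + 1) * (U / #B ^ p) := by
      rw [← mul_div_assoc, le_div_iff₀ (by positivity)]
      calc _ = (#D : ℝ) ^ 2 * (3 / 4 * #B : ℝ) ^ p := by rw [mul_pow]; ring
        _ ≤ _ := h1
    have h4 : (2 : ℝ) ^ p * 2 ^ (l + 1) ≤ 4 ^ p * (3 / 4) ^ p := by
      rw [hp, pow_mul, pow_mul, pow_mul, ← mul_pow, ← mul_pow]
      exact pow_le_pow_left₀ (by norm_num) (by norm_num) _
    refine le_of_mul_le_mul_right ?_ (show (0 : ℝ) < 2 ^ (l + 1) by positivity)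
    calc (2 : ℝ) ^ p * #D ^ 2 * 2 ^ (l + 1) = 2 ^ p * 2 ^ (l + 1) * #D ^ 2 := by ring
      _ ≤ 4 ^ p * (3 / 4) ^ p * (#D : ℝ) ^ 2 := by gcongr
      _ = 4 ^ p * ((#D : ℝ) ^ 2 * (3 / 4) ^ p) := by ring
      _ ≤ 4 ^ p * (2 ^ (l + 1) * (U / #B ^ p)) := by gcongr
      _ = _ := by ring
  have h3 := h2.trans hmom
  calc _ ≤ ((#B : ℝ) ^ (5 * p + 1) / (#A ^ 2) ^ (5 * p + 1) * V) *
        ((#A : ℝ) ^ 2 / #B) ^ (5 * p + 1) := by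
          rw [← div_pow]; exact mul_le_mul_of_nonneg_right h3 (by positivity)
    _ = V := by rw [div_pow]; field_simp

end DensityMoments

section Window

variable {κ : Type*} {S : Finset κ} {N : κ → ℝ}

lemma moment_pos (hN : ∀ x ∈ S, 0 ≤ N x) {q : ℕ} (hq0 : 0 < q) (hq : 0 < ∑ x ∈ S, N x ^ q) (i : ℕ) :
    0 < ∑ x ∈ S, N x ^ i := by
  obtain ⟨x, hx, hpos⟩ := exists_lt_of_sum_lt (s := S) (f := fun _ ↦ (0 : ℝ)) (by simpa using hq)
  have hx0 : 0 < N x := (hN x hx).lt_of_ne fun h ↦ by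
    rw [← h, zero_pow hq0.ne'] at hpos; exact hpos.false
  exact sum_pos' (fun y hy ↦ pow_nonneg (hN y hy) _) ⟨x, hx, pow_pos hx0 i⟩

lemma moment_sq_le (hN : ∀ x ∈ S, 0 ≤ N x) (i : ℕ) :
    (∑ x ∈ S, N x ^ (i + 1)) ^ 2 ≤ (∑ x ∈ S, N x ^ i) * ∑ x ∈ S, N x ^ (i + 2) := by
  refine sum_sq_le_sum_mul_sum_of_sq_le_mul S (fun x hx ↦ pow_nonneg (hN x hx) _)
    (fun x hx ↦ pow_nonneg (hN x hx) _) fun x _ ↦ by ring_nf; rfl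

/-- Consecutive ratios of moments are nondecreasing. -/
lemma moment_ratio_monotone (hN : ∀ x ∈ S, 0 ≤ N x) (hpos : ∀ i : ℕ, 0 < ∑ x ∈ S, N x ^ i) :
    Monotone fun i : ℕ ↦ (∑ x ∈ S, N x ^ (i + 1)) / ∑ x ∈ S, N x ^ i :=
  monotone_nat_of_le_succ fun i ↦ by
    rw [div_le_div_iff₀ (hpos _) (hpos _), ← sq, mul_comm]
    exact moment_sq_le hN i

lemma two_le_one_add_pow : (2 : ℝ) ≤ (1 + 1 / 400) ^ 400 := by
  have := one_add_mul_le_pow (show (-2 : ℝ) ≤ 1 / 400 by norm_num) 400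
  have h : 1 + ((400 : ℕ) : ℝ) * (1 / 400) = 2 := by norm_num
  exact h ▸ this

lemma exists_pow_le_inv_4096 : ∃ w : ℕ, w = 4800 ∧ (1 - 1 / 400 : ℝ) ^ w ≤ 1 / 4096 := by
  have h3 : (1 - 1 / 400 : ℝ) ^ 400 ≤ 1 / 2 := by
    have h4 : (1 - 1 / 400 : ℝ) ^ 400 ≤ Real.exp (-(1 / 400)) ^ 400 :=
      pow_le_pow_left₀ (by norm_num) (Real.one_sub_le_exp_neg _) _
    rw [← Real.exp_nat_mul] at h4
    refine h4.trans ?_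
    rw [show ((400 : ℕ) : ℝ) * -(1 / 400) = -1 by norm_num, Real.exp_neg, one_div]
    exact inv_anti₀ (by norm_num) (by linarith [Real.add_one_le_exp 1])
  refine ⟨400 * 12, rfl, ?_⟩
  rw [pow_mul]
  exact (pow_le_pow_left₀ (pow_nonneg (by norm_num) _) h3 _).trans (by norm_num)

/-- If the moments of a bounded function grow, then at some exponent `P` the weight `N ^ P` is
concentrated near a value `M`. -/
lemma exists_flat_window {L : ℕ} (hL : 1 ≤ L) {lam a : ℝ} (hN : ∀ x ∈ S, 0 ≤ N x)
    (hNa : ∀ x ∈ S, N x ≤ a) (hlam : 0 < lam) (ha : a ≤ 2 ^ L * lam) (hS : 0 < #S)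
    (hm : 2 ^ (2 * L) * #S * lam ^ (5 * (2 * L) + 1) ≤ ∑ x ∈ S, N x ^ (5 * (2 * L) + 1)) :
    ∃ P ≤ 1920011 * L, ∃ M, 1.12 * lam ≤ M ∧ lam ^ P * #S ≤ ∑ x ∈ S, N x ^ P ∧
      ∑ x ∈ S, N x ^ (P + 1) ≤ (1 + 1 / 400) * M * ∑ x ∈ S, N x ^ P ∧
      ∑ x ∈ S with N x < (1 - 1 / 400) * M, N x ^ P ≤ 1 / 4096 * ∑ x ∈ S, N x ^ P := by
  obtain ⟨w, hw4800, hw⟩ := exists_pow_le_inv_4096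
  set q := 5 * (2 * L) + 1 with hq
  set m : ℕ → ℝ := fun i ↦ ∑ x ∈ S, N x ^ i with hmdef
  have hS' : (0 : ℝ) < #S := by exact_mod_cast hS
  have hmq : 0 < m q := lt_of_lt_of_le (by positivity) hm
  have hpos : ∀ i, 0 < m i := moment_pos hN (by omega) hmq
  set R : ℕ → ℝ := fun i ↦ m (i + 1) / m i with hR
  have hmono : Monotone R := moment_ratio_monotone hN hpos
  have hRm : ∀ i, m (i + 1) = R i * m i := fun i ↦ (div_mul_cancel₀ _ (hpos i).ne').symm
  have hR0 : ∀ i, 0 < R i := fun i ↦ div_pos (hpos _) (hpos _)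
  have hRa : ∀ i, R i ≤ a := fun i ↦ by
    rw [hR, div_le_iff₀ (hpos i), hmdef, mul_sum]
    refine sum_le_sum fun x hx ↦ ?_
    rw [pow_succ']; exact mul_le_mul_of_nonneg_right (hNa x hx) (pow_nonneg (hN x hx) _)
  have hlow : ∀ i k, R i ^ k * m i ≤ m (i + k) := by
    intro i k
    induction k with
    | zero => simp
    | succ k ih =>
      rw [← add_assoc, hRm, pow_succ', mul_assoc]
      exact mul_le_mul (hmono (by omega)) ih (mul_nonneg (pow_nonneg (hR0 _).le _) (hpos _).le)
        (hR0 _).le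
  have hup : ∀ k ≤ q, m k ≤ R q ^ k * m 0 := by
    intro k hk
    induction k with
    | zero => simp
    | succ k ih =>
      rw [hRm, pow_succ', mul_assoc]
      exact mul_le_mul (hmono (by omega)) (ih (by omega)) (hpos _).le (hR0 _).le
  have hRq : 1.12 * lam ≤ R q := by
    by_contra! hcon
    have h1 := hm.trans (hup q le_rfl)
    have h2 : m 0 = #S := by simp [hmdef]
    have h3 : R q ^ q ≤ (1.12 * lam) ^ q := pow_le_pow_left₀ (hR0 q).le hcon.le _
    rw [h2, mul_right_comm] at h1
    have h4 := (le_of_mul_le_mul_right h1 hS').trans h3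
    rw [mul_pow] at h4
    have h5 := le_of_mul_le_mul_right h4 (pow_pos hlam q)
    have h6 : (1.12 : ℝ) ^ q ≤ (1.12 ^ 6) ^ (2 * L) := by
      rw [← pow_mul]; exact pow_le_pow_right₀ (by norm_num) (by omega)
    have h7 : ((1.12 : ℝ) ^ 6) ^ (2 * L) < 2 ^ (2 * L) :=
      pow_lt_pow_left₀ (by norm_num) (by norm_num) (by omega)
    linarith
  have hwin : ∃ j < 400 * L, R (q + (j + 1) * w) ≤ (1 + 1 / 400) * R (q + j * w) := by
    by_contra! hcon
    have h1 : ∀ j ≤ 400 * L, (1 + 1 / 400) ^ j * (1.12 * lam) ≤ R (q + j * w) := by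
      intro j hj
      induction j with
      | zero => simpa using hRq
      | succ j ih =>
        have h2 := ih (by omega)
        have h3 := hcon j (by omega)
        rw [pow_succ', mul_assoc]
        nlinarith
    have h2 := (h1 _ le_rfl).trans (hRa _)
    have h3 : (2 : ℝ) ^ L ≤ (1 + 1 / 400) ^ (400 * L) := by
      rw [pow_mul]
      exact pow_le_pow_left₀ (by norm_num) two_le_one_add_pow _
    have h4 : (2 : ℝ) ^ L * (1.12 * lam) ≤ 2 ^ L * lam :=
      (mul_le_mul_of_nonneg_right h3 (by positivity)).trans (h2.trans ha)
    have h5 := le_of_mul_le_mul_left h4 (by positivity)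
    linarith
  obtain ⟨j, hj, hjR⟩ := hwin
  set Q := q + j * w with hQ
  have hP : q + (j + 1) * w = Q + w := by rw [hQ]; ring
  rw [hP] at hjR
  have hM : 1.12 * lam ≤ R Q := hRq.trans (hmono (by omega))
  refine ⟨Q + w, by subst hw4800; omega, R Q, hM, ?_, ?_, ?_⟩
  · have h1 := hlow q (Q + w - q)
    rw [show q + (Q + w - q) = Q + w by omega] at h1
    refine le_trans ?_ h1
    have h2 : lam ^ (Q + w) * #S = lam ^ (Q + w - q) * (lam ^ q * #S) := by
      rw [← mul_assoc, ← pow_add]; congr 2; omega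
    rw [h2]
    refine mul_le_mul (pow_le_pow_left₀ hlam.le (by linarith) _) (le_trans ?_ hm)
      (mul_nonneg (pow_nonneg hlam.le _) hS'.le)
      (pow_nonneg (hR0 _).le _)
    rw [mul_assoc, mul_comm (lam ^ q)]
    exact le_mul_of_one_le_left (mul_nonneg hS'.le (pow_nonneg hlam.le _))
      (one_le_pow₀ (by norm_num))
  · change m _ ≤ _ * m _
    rw [hRm]
    exact mul_le_mul_of_nonneg_right hjR (hpos _).le
  · have h1 : ∑ x ∈ S with N x < (1 - 1 / 400) * R Q, N x ^ (Q + w) ≤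
        ((1 - 1 / 400) * R Q) ^ w * m Q := by
      rw [hmdef, mul_sum]
      refine (sum_le_sum fun x hx ↦ ?_).trans (sum_le_sum_of_subset_of_nonneg (filter_subset _ S)
        fun x hx _ ↦ mul_nonneg (pow_nonneg (mul_nonneg (by norm_num) (hR0 _).le) _)
          (pow_nonneg (hN x hx) _))
      obtain ⟨hx, hlt⟩ := mem_filter.1 hx
      rw [add_comm, pow_add]
      exact mul_le_mul_of_nonneg_right (pow_le_pow_left₀ (hN x hx) hlt.le _)
        (pow_nonneg (hN x hx) _)
    refine h1.trans ?_
    rw [mul_pow, mul_assoc]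
    exact mul_le_mul hw (hlow Q w) (mul_nonneg (pow_nonneg (hR0 _).le _) (hpos _).le)
      (by norm_num)

end Window

section Sifting

variable {G : Type*} [AddCommGroup G]

lemma sum_sum_mul_prod_ind (A D : Finset G) (ψ : G → G → ℝ) {P : ℕ} (s : Fin P → G) :
    ∑ x ∈ D, ∑ y ∈ D, ψ x y * ((∏ i, ind A (x + s i)) * ∏ i, ind A (y + s i)) =
      ∑ x ∈ D with ∀ i, x + s i ∈ A, ∑ y ∈ D with ∀ i, y + s i ∈ A, ψ x y := by
  have h : ∀ x, ∏ i, ind A (x + s i) = if ∀ i, x + s i ∈ A then 1 else 0 := by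
    intro x
    simp only [ind, prod_ite_zero, prod_const_one, mem_univ, true_implies]
  simp only [h, sum_filter]
  refine sum_congr rfl fun x _ ↦ ?_
  split_ifs with hx
  · refine sum_congr rfl fun y _ ↦ ?_
    split_ifs <;> simp
  · simp

variable [Fintype G]

/-- Sifting: a set `X` on most of whose differences the autocorrelation of `A` is at least
about `M`, while being about `M` on average. -/
lemma exists_sifted {A B D : Finset G} {L : ℕ} (hL : 1 ≤ L) (hA : 0 < #A) (hD : 0 < #D)
    (hDB : ∀ x ∈ D, ∀ a ∈ A, a - x ∈ B) (hAB : #B ≤ 2 ^ L * #A)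
    (hmom : 2 ^ (2 * L) * (#D : ℝ) ^ 2 * ((#A : ℝ) ^ 2 / #B) ^ (5 * (2 * L) + 1) ≤
      ∑ x ∈ D, ∑ y ∈ D, corr (ind A) (x - y) ^ (5 * (2 * L) + 1)) :
    ∃ X ⊆ D, ∃ M : ℝ, 1.12 * ((#A : ℝ) ^ 2 / #B) ≤ M ∧ X.Nonempty ∧
      (#D : ℝ) ≤ 2 ^ (1920017 * L ^ 2) * #X ∧
      ∑ x ∈ X, ∑ y ∈ X, corr (ind A) (x - y) ≤ (1 + 2 / 400) * M * (#X : ℝ) ^ 2 ∧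
      ∑ x ∈ X, (#{y ∈ X | corr (ind A) (x - y) < (1 - 1 / 400) * M} : ℝ) ≤
        3 / 400 * (#X : ℝ) ^ 2 := by
  have hB : 0 < #B := by
    obtain ⟨a, ha⟩ := card_pos.1 hA
    obtain ⟨x, hx⟩ := card_pos.1 hD
    exact card_pos.2 ⟨_, hDB x hx a ha⟩
  have hA' : (0 : ℝ) < #A := by exact_mod_cast hA
  have hB' : (0 : ℝ) < #B := by exact_mod_cast hB
  have hD' : (0 : ℝ) < #D := by exact_mod_cast hD
  have hAB' : (#B : ℝ) ≤ 2 ^ L * #A := by exact_mod_cast hAB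
  set lam : ℝ := (#A : ℝ) ^ 2 / #B with hlam
  have hlam0 : 0 < lam := by positivity
  set N : G × G → ℝ := fun z ↦ corr (ind A) (z.1 - z.2) with hN
  have hcard : (#(D ×ˢ D) : ℝ) = (#D : ℝ) ^ 2 := by rw [card_product]; push_cast; ring
  obtain ⟨P, hP, M, hM, hmP, hmP1, hbad⟩ := exists_flat_window (S := D ×ˢ D) (N := N)
    (a := #A) hL (fun z _ ↦ corr_ind_nonneg _ _) (fun z _ ↦ corr_ind_le _ _) hlam0
    (by
      rw [hlam, ← mul_div_assoc, le_div_iff₀ hB', sq]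
      nlinarith) (card_pos.2 ((card_pos.1 hD).product (card_pos.1 hD)))
    (by rw [sum_product, hcard]; exact hmom)
  have hM0 : 0 < M := lt_of_lt_of_le (by positivity) hM
  set m : ℝ := ∑ z ∈ D ×ˢ D, N z ^ P with hm
  have hm0 : 0 < m := lt_of_lt_of_le (by rw [hcard]; positivity) hmP
  set X : (Fin P → G) → Finset G := fun s ↦ {x ∈ D | ∀ i, x + s i ∈ A} with hX
  set ψ : G → G → ℝ := fun x y ↦ corr (ind A) (x - y) / M +
    2 * (if corr (ind A) (x - y) < (1 - 1 / 400) * M then 1 else 0) with hψ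
  have hsift : ∀ ξ : G → G → ℝ, ∑ s : Fin P → G, ∑ x ∈ X s, ∑ y ∈ X s, ξ x y =
      ∑ z ∈ D ×ˢ D, ξ z.1 z.2 * N z ^ P := by
    intro ξ
    rw [sum_product]
    simp_rw [hN, corr_sub]
    rw [sum_mul_sum_pow D D ξ (fun x s ↦ ind A (x + s)) (fun x s ↦ ind A (x + s)) P]
    exact sum_congr rfl fun s _ ↦ (sum_sum_mul_prod_ind A D ξ s).symm
  have hone : ∑ s : Fin P → G, (#(X s) : ℝ) ^ 2 = m := by
    have := hsift fun _ _ ↦ 1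
    simp only [sum_const, nsmul_eq_mul, mul_one, one_mul, ← sq] at this
    exact this
  have hψsum : ∑ s : Fin P → G, ∑ x ∈ X s, ∑ y ∈ X s, ψ x y ≤ (1 + 1 / 400 + 2 / 4096) * m := by
    rw [hsift]
    have h1 : ∀ z ∈ D ×ˢ D, ψ z.1 z.2 * N z ^ P = N z ^ (P + 1) / M +
        2 * (if N z < (1 - 1 / 400) * M then N z ^ P else 0) := by
      intro z _
      simp only [hψ, hN]
      split_ifs <;> ring
    rw [sum_congr rfl h1, sum_add_distrib, ← sum_div, ← mul_sum, ← sum_filter]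
    have h2 : (∑ z ∈ D ×ˢ D, N z ^ (P + 1)) / M ≤ (1 + 1 / 400) * m := by
      rw [div_le_iff₀ hM0]; linarith
    linarith
  set thr : ℝ := 1 / 1600 * ((#A / #B : ℝ) ^ P * #D) ^ 2 with hthr
  have hex : ∃ s, thr < (#(X s) : ℝ) ^ 2 ∧
      ∑ x ∈ X s, ∑ y ∈ X s, ψ x y ≤ (1 + 2 / 400) * (#(X s) : ℝ) ^ 2 := by
    by_contra! hcon
    have hψ0 : ∀ x y, 0 ≤ ψ x y := fun x y ↦ add_nonneg
      (div_nonneg (corr_ind_nonneg _ _) hM0.le) (by split_ifs <;> norm_num)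
    have h1 : ∀ s, (1 + 2 / 400) * (#(X s) : ℝ) ^ 2 ≤ ∑ x ∈ X s, ∑ y ∈ X s, ψ x y +
        (1 + 2 / 400) * thr * (if s ∈ Fintype.piFinset fun _ ↦ B then 1 else 0) := by
      intro s
      have h0 : 0 ≤ ∑ x ∈ X s, ∑ y ∈ X s, ψ x y :=
        sum_nonneg fun x _ ↦ sum_nonneg fun y _ ↦ hψ0 x y
      have hthr0 : 0 ≤ thr := by positivity
      rcases lt_or_ge thr ((#(X s) : ℝ) ^ 2) with h | h
      · refine (hcon s h).le.trans (le_add_of_nonneg_right ?_)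
        split_ifs <;> simp; positivity
      · by_cases hs : s ∈ Fintype.piFinset fun _ ↦ B
        · rw [if_pos hs]; linarith
        · have hempty : X s = ∅ := by
            by_contra hne
            obtain ⟨x, hx⟩ := nonempty_iff_ne_empty.2 hne
            obtain ⟨hxD, hx⟩ := mem_filter.1 hx
            exact hs (Fintype.mem_piFinset.2 fun i ↦ by simpa using hDB x hxD _ (hx i))
          simp [hempty, hs]
    have h2 := sum_le_sum fun s (_ : s ∈ univ) ↦ h1 s
    rw [← mul_sum, hone, sum_add_distrib, ← mul_sum, sum_boole, filter_mem_eq_inter, univ_inter,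
      Fintype.card_piFinset_const] at h2
    have h3 : thr * ((#B ^ P : ℕ) : ℝ) ≤ 1 / 1600 * m := by
      refine le_trans (le_of_eq ?_) (mul_le_mul_of_nonneg_left hmP (by norm_num))
      rw [hthr, hcard, hlam]
      simp only [div_pow, mul_pow, Nat.cast_pow]
      rw [pow_right_comm (#A : ℝ) 2 P]
      field_simp
    rw [mul_assoc] at h2
    linarith
  obtain ⟨s, hs1, hs2⟩ := hex
  have hXcard : (#A / #B : ℝ) ^ P * #D < 40 * #(X s) := by
    refine lt_of_pow_lt_pow_left₀ 2 (by positivity) ?_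
    rw [mul_pow (40 : ℝ)]
    linarith
  have hXne : (X s).Nonempty := by
    rw [← card_pos]
    have : (0 : ℝ) < 40 * #(X s) := lt_of_le_of_lt (by positivity) hXcard
    exact_mod_cast (pos_of_mul_pos_right this (by norm_num))
  refine ⟨X s, filter_subset _ _, M, hM, hXne, ?_, ?_⟩
  · have h1 : (1 / 2 ^ L : ℝ) ≤ #A / #B := by
      rw [div_le_div_iff₀ (by positivity) hB', one_mul, mul_comm]; exact hAB'
    have h2 : (1 / 2 ^ L : ℝ) ^ P * #D ≤ 40 * #(X s) :=
      (mul_le_mul_of_nonneg_right (pow_le_pow_left₀ (by positivity) h1 _) hD'.le).trans hXcard.le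
    rw [div_pow, one_pow, ← pow_mul, div_mul_eq_mul_div, one_mul, div_le_iff₀ (by positivity)] at h2
    calc (#D : ℝ) ≤ 40 * #(X s) * 2 ^ (L * P) := h2
      _ ≤ 2 ^ 6 * #(X s) * 2 ^ (L * P) := by gcongr; norm_num
      _ = 2 ^ (6 + L * P) * #(X s) := by rw [pow_add]; ring
      _ ≤ _ := by
        gcongr
        · norm_num
        · have h3 := Nat.mul_le_mul_left L hP
          have h4 : 1 ≤ L ^ 2 := Nat.one_le_pow _ _ hL
          linarith
  · set β : ℝ := ∑ x ∈ X s, (#{y ∈ X s | corr (ind A) (x - y) < (1 - 1 / 400) * M} : ℝ) with hβ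
    set T : ℝ := ∑ x ∈ X s, ∑ y ∈ X s, corr (ind A) (x - y) with hT
    have hβ' : β = ∑ x ∈ X s, ∑ y ∈ X s,
        if corr (ind A) (x - y) < (1 - 1 / 400) * M then (1 : ℝ) else 0 := by
      simp only [hβ, sum_boole]
    have h1 : T / M + 2 * β ≤ (1 + 2 / 400) * (#(X s) : ℝ) ^ 2 := by
      refine le_trans (le_of_eq ?_) hs2
      simp only [hψ, sum_add_distrib, ← sum_div, ← mul_sum, hβ', hT]
    have hβ0 : 0 ≤ β := sum_nonneg fun _ _ ↦ by positivity
    have h2 : (1 - 1 / 400) * ((#(X s) : ℝ) ^ 2 - β) ≤ T / M := by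
      have : ((#(X s) : ℝ) ^ 2) = ∑ x ∈ X s, ∑ y ∈ X s, (1 : ℝ) := by simp [sq]
      rw [hβ', this, hT, ← sum_sub_distrib, mul_sum, sum_div]
      refine sum_le_sum fun x _ ↦ ?_
      rw [← sum_sub_distrib, mul_sum, sum_div]
      refine sum_le_sum fun y _ ↦ ?_
      rw [le_div_iff₀ hM0]
      split_ifs with h
      · simpa using corr_ind_nonneg A (x - y)
      · linarith
    constructor
    · have h3 : T / M ≤ (1 + 2 / 400) * (#(X s) : ℝ) ^ 2 := by linarith
      rw [div_le_iff₀ hM0] at h3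
      linarith
    · linarith

end Sifting

section AlmostPeriods

variable {G : Type*}

lemma prod_ind_div_card (X : Finset G) {m : ℕ} (a : Fin m → G) :
    ∏ i, ind X (a i) / #X =
      if a ∈ Fintype.piFinset fun _ ↦ X then (1 : ℝ) / #X ^ m else 0 := by
  rw [prod_div_distrib, prod_const, card_univ, Fintype.card_fin]
  simp only [ind, prod_ite_zero, prod_const_one, mem_univ, true_implies, Fintype.mem_piFinset]
  split_ifs <;> simp

lemma two_mul_two_pow_mul_exp_le {k : ℕ} (hk : 1 ≤ k) :
    2 * 2 ^ k * Real.exp (-(12 * k)) ≤ 1 / 800 := by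
  have h1 : Real.exp (-(12 * k)) ≤ (1 / 2) ^ (12 * k) := by
    have h2 : Real.exp (-1) ≤ 1 / 2 := by
      rw [Real.exp_neg, one_div]
      exact inv_anti₀ (by norm_num) (by linarith [Real.add_one_le_exp 1])
    calc Real.exp (-(12 * k)) = Real.exp (-1) ^ (12 * k) := by
          rw [← Real.exp_nat_mul]; push_cast; ring_nf
      _ ≤ _ := pow_le_pow_left₀ (Real.exp_pos _).le h2 _
  have h3 : (2 : ℝ) ^ k * (1 / 2) ^ (12 * k) = (1 / 2048) ^ k := by
    rw [pow_mul, ← mul_pow]; norm_num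
  have h4 : (1 / 2048 : ℝ) ^ k ≤ 1 / 2048 :=
    (pow_le_pow_of_le_one (by norm_num) (by norm_num) hk).trans_eq (pow_one _)
  have h5 : (2 : ℝ) ^ k * Real.exp (-(12 * k)) ≤ 2 ^ k * (1 / 2) ^ (12 * k) := by gcongr
  linarith

variable [Fintype G]

/-- Most samples of size `m` from `X` are good at approximating an average over `X`. -/
lemma card_good_samples_ge {X Y : Finset G} {k : ℕ} (hk : 1 ≤ k) (hX : X.Nonempty)
    (hYX : #Y ≤ 2 ^ k * #X) (bad : G → G → Prop) :
    (#X : ℝ) ^ (15360000 * k) ≤ 2 * #{a ∈ Fintype.piFinset fun _ : Fin (15360000 * k) ↦ X |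
      (#{x ∈ Y | 1 / 400 < |(∑ i, if bad x (a i) then (1 : ℝ) else 0) / (15360000 * k : ℕ) -
        #{y ∈ X | bad x y} / #X|} : ℝ) ≤ 1 / 400 * #X} := by
  obtain ⟨m, hm⟩ : ∃ m, m = 15360000 * k := ⟨_, rfl⟩
  rw [← hm]
  have hX' : (0 : ℝ) < #X := by exact_mod_cast hX.card_pos
  have hYX' : (#Y : ℝ) ≤ 2 ^ k * #X := by exact_mod_cast hYX
  have hmean : ∀ x, ∑ j, ind X j / #X * (if bad x j then (1 : ℝ) else 0) =
      #{y ∈ X | bad x y} / #X := by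
    intro x
    simp_rw [div_mul_eq_mul_div]
    rw [← sum_div, sum_congr rfl fun j _ ↦ mul_comm _ _, sum_mul_ind, sum_boole]
  have h := sum_prod_mul_card_deviation_le (w := fun x ↦ ind X x / #X)
    (fun x ↦ div_nonneg (ind_nonneg _ _) hX'.le) (by rw [← sum_div, sum_ind, div_self hX'.ne']) Y
    (z := fun x y ↦ if bad x y then 1 else 0) (fun x y ↦ by split_ifs <;> simp)
    (m := m) (by omega) (η := 1 / 400) (by norm_num)
  simp only [hmean, prod_ind_div_card, ite_mul, zero_mul] at h
  rw [sum_ite_mem, univ_inter, ← mul_sum] at h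
  have hexp : (1 / 400 : ℝ) ^ 2 * m / 8 = 12 * k := by rw [hm]; push_cast; ring
  rw [hexp] at h
  set S := Fintype.piFinset fun _ : Fin m ↦ X with hS
  set E : (Fin m → G) → ℝ := fun a ↦
    (#{x ∈ Y | 1 / 400 < |(∑ i, if bad x (a i) then (1 : ℝ) else 0) / (m : ℕ) -
        #{y ∈ X | bad x y} / #X|} : ℝ) with hE
  have hScard : (#S : ℝ) = #X ^ m := by rw [hS, Fintype.card_piFinset_const]; push_cast; rfl
  have h1 : ∑ a ∈ S, E a ≤ #X ^ m * (1 / 800 * #X) := by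
    have hpow : (0 : ℝ) < #X ^ m := pow_pos hX' m
    rw [one_div_mul_eq_div, div_le_iff₀' hpow] at h
    refine h.trans (mul_le_mul_of_nonneg_left ?_ hpow.le)
    calc 2 * #Y * Real.exp (-(12 * k)) ≤ 2 * (2 ^ k * #X) * Real.exp (-(12 * k)) := by gcongr
      _ = 2 * 2 ^ k * Real.exp (-(12 * k)) * #X := by ring
      _ ≤ _ := mul_le_mul_of_nonneg_right (two_mul_two_pow_mul_exp_le hk) hX'.le
  have h2 : (#{a ∈ S | ¬ E a ≤ 1 / 400 * #X} : ℝ) * (1 / 400 * #X) ≤ ∑ a ∈ S, E a := by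
    rw [← nsmul_eq_mul, ← sum_const]
    refine (sum_le_sum fun a ha ↦ (not_le.1 (mem_filter.1 ha).2).le).trans
      (sum_le_sum_of_subset_of_nonneg (filter_subset _ _) fun a _ _ ↦ by positivity)
  have h3 : (#{a ∈ S | E a ≤ 1 / 400 * #X} : ℝ) + #{a ∈ S | ¬ E a ≤ 1 / 400 * #X} = #S := by
    exact_mod_cast card_filter_add_card_filter_not (s := S) (p := fun a ↦ E a ≤ 1 / 400 * #X)
  have h4 : (#{a ∈ S | ¬ E a ≤ 1 / 400 * #X} : ℝ) ≤ #X ^ m / 2 := by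
    refine le_of_mul_le_mul_right (h2.trans (h1.trans_eq ?_))
      (show (0 : ℝ) < 1 / 400 * #X by positivity)
    ring
  rw [hScard] at h3
  linarith

variable [AddCommGroup G]

/-- Croot–Sisask almost-periodicity. -/
lemma exists_almost_periods {X D E Y : Finset G} {k : ℕ} (hk : 1 ≤ k) (hX : X.Nonempty)
    (hD : D.Nonempty) (hE : ∀ x ∈ X, ∀ t ∈ D, x - t ∈ E)
    (hY : ∀ x ∈ X, ∀ t ∈ D, ∀ t' ∈ D, x + (t - t') ∈ Y) (hYX : #Y ≤ 2 ^ k * #X)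
    (hEX : #E ≤ 2 ^ k * #X) (bad : G → Prop)
    (hbad : ∑ x ∈ X, (#{y ∈ X | bad (x - y)} : ℝ) ≤ 3 / 400 * (#X : ℝ) ^ 2) :
    ∃ T ⊆ D, ∃ t₀ ∈ T, (#D : ℝ) ≤ 2 ^ (15360001 * k ^ 2) * #T ∧
      ∀ t ∈ T, ∑ x ∈ X, (#{y ∈ X | bad (x + (t - t₀) - y)} : ℝ) ≤ 7 / 400 * (#X : ℝ) ^ 2 := by
  have hX' : (0 : ℝ) < #X := by exact_mod_cast hX.card_pos
  have hD' : (0 : ℝ) < #D := by exact_mod_cast hD.card_pos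
  have hEX' : (#E : ℝ) ≤ 2 ^ k * #X := by exact_mod_cast hEX
  have hgood := card_good_samples_ge hk hX hYX fun x y ↦ bad (x - y)
  obtain ⟨m, hm⟩ : ∃ m, m = 15360000 * k := ⟨_, rfl⟩
  rw [← hm] at hgood
  set g : G → ℝ := fun x ↦ #{y ∈ X | bad (x - y)} / #X with hg
  set h : (Fin m → G) → G → ℝ := fun a x ↦ (∑ i, if bad (x - a i) then (1 : ℝ) else 0) / m with hh
  set good : Finset (Fin m → G) := {a ∈ Fintype.piFinset fun _ : Fin m ↦ X |
    (#{x ∈ Y | 1 / 400 < |h a x - g x|} : ℝ) ≤ 1 / 400 * #X} with hgooddef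
  have hEne : E.Nonempty := by
    obtain ⟨x, hx⟩ := hX
    obtain ⟨t, ht⟩ := hD
    exact ⟨_, hE x hx t ht⟩
  obtain ⟨b, -, hb⟩ : ∃ b ∈ Fintype.piFinset fun _ : Fin m ↦ E,
      (#D * #good : ℝ) / #E ^ m ≤ #{t ∈ D | (fun i ↦ b i + t) ∈ good} := by
    refine exists_le_of_sum_le (s := Fintype.piFinset fun _ : Fin m ↦ E) ?_ ?_
    · exact Fintype.piFinset_nonempty.2 fun _ ↦ hEne
    · have hE0 : (0 : ℝ) < #E ^ m := pow_pos (by exact_mod_cast hEne.card_pos) m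
      rw [sum_const, Fintype.card_piFinset_const, nsmul_eq_mul, Nat.cast_pow,
        mul_div_cancel₀ _ hE0.ne']
      simp_rw [card_filter]
      push_cast
      rw [sum_comm, ← nsmul_eq_mul, ← sum_const]
      refine sum_le_sum fun t ht ↦ ?_
      rw [sum_boole]
      norm_cast
      refine card_le_card_of_injOn (fun a i ↦ a i - t) ?_ ?_
      · intro a ha
        have ha' := Fintype.mem_piFinset.1 (mem_filter.1 ha).1
        refine mem_filter.2 ⟨Fintype.mem_piFinset.2 fun i ↦ hE _ (ha' i) t ht, ?_⟩
        simpa using ha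
      · intro a _ a' _ haa
        funext i
        exact sub_left_injective (congrFun haa i)
  set T : Finset G := {t ∈ D | (fun i ↦ b i + t) ∈ good} with hT
  have hTcard : (#D : ℝ) ≤ 2 ^ (15360001 * k ^ 2) * #T := by
    have hE0 : (0 : ℝ) < #E ^ m := pow_pos (by exact_mod_cast hEne.card_pos) m
    rw [div_le_iff₀ hE0] at hb
    have h1 : (#E : ℝ) ^ m ≤ 2 ^ (k * m) * #X ^ m := by
      rw [pow_mul, ← mul_pow]; exact pow_le_pow_left₀ (by positivity) hEX' m
    have hXm : (0 : ℝ) < #X ^ m := pow_pos hX' m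
    have h2 : (#D : ℝ) * #X ^ m ≤ 2 * 2 ^ (k * m) * #T * #X ^ m := by
      calc (#D : ℝ) * #X ^ m ≤ #D * (2 * #good) := by gcongr
        _ = 2 * (#D * #good) := by ring
        _ ≤ 2 * (#T * #E ^ m) := by gcongr
        _ ≤ 2 * (#T * (2 ^ (k * m) * #X ^ m)) := by gcongr
        _ = _ := by ring
    refine (le_of_mul_le_mul_right h2 hXm).trans ?_
    rw [← pow_succ']
    gcongr
    · norm_num
    · have h4 : 1 ≤ k ^ 2 := Nat.one_le_pow _ _ hk
      rw [hm]
      linarith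
  have hTne : T.Nonempty := by
    rw [← card_pos]
    by_contra! h0
    rw [Nat.le_zero.1 h0] at hTcard
    simp at hTcard
    exact hD.ne_empty hTcard
  obtain ⟨t₀, ht₀⟩ := hTne
  refine ⟨T, filter_subset _ _, t₀, ht₀, hTcard, fun t ht ↦ ?_⟩
  obtain ⟨htD, htg⟩ := mem_filter.1 ht
  obtain ⟨ht₀D, ht₀g⟩ := mem_filter.1 ht₀
  have htg := (mem_filter.1 htg).2
  have ht₀g := (mem_filter.1 ht₀g).2
  set S := {x ∈ Y | 1 / 400 < |h (fun i ↦ b i + t) x - g x|} with hS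
  set S₀ := {x ∈ Y | 1 / 400 < |h (fun i ↦ b i + t₀) x - g x|} with hS₀
  have hshift : ∀ x, h (fun i ↦ b i + t) (x + (t - t₀)) = h (fun i ↦ b i + t₀) x := by
    intro x
    simp only [hh]
    congr 1
    refine sum_congr rfl fun i _ ↦ ?_
    rw [show x + (t - t₀) - (b i + t) = x - (b i + t₀) by abel]
  have hg0 : ∀ x, 0 ≤ g x := fun x ↦ by positivity
  have hg1 : ∀ x, g x ≤ 1 := fun x ↦ by
    rw [hg, div_le_one hX']
    exact_mod_cast card_le_card (filter_subset _ _)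
  have hpt : ∀ x ∈ X, g (x + (t - t₀)) ≤ g x + 2 / 400 + (if x ∈ S₀ then 1 else 0) +
      (if x + (t - t₀) ∈ S then 1 else 0) := by
    intro x hx
    by_cases h1 : x ∈ S₀
    · rw [if_pos h1]
      have : (0 : ℝ) ≤ if x + (t - t₀) ∈ S then 1 else 0 := by split_ifs <;> norm_num
      linarith [hg0 x, hg1 (x + (t - t₀))]
    by_cases h2 : x + (t - t₀) ∈ S
    · rw [if_pos h2, if_neg h1]
      linarith [hg0 x, hg1 (x + (t - t₀))]
    rw [if_neg h1, if_neg h2]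
    have hxY : x ∈ Y := by simpa using hY x hx t₀ ht₀D t₀ ht₀D
    have e1 := not_lt.1 fun hlt ↦ h1 (mem_filter.2 ⟨hxY, hlt⟩)
    have e2 := not_lt.1 fun hlt ↦ h2 (mem_filter.2 ⟨hY x hx t htD t₀ ht₀D, hlt⟩)
    rw [hshift] at e2
    linarith [(abs_le.1 e1).2, (abs_le.1 e2).1]
  have hsum := sum_le_sum hpt
  rw [sum_add_distrib, sum_add_distrib, sum_add_distrib, sum_const, nsmul_eq_mul, sum_boole,
    sum_boole] at hsum
  have hc₀ : (#{x ∈ X | x ∈ S₀} : ℝ) ≤ #S₀ := by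
    exact_mod_cast card_le_card fun x hx ↦ (mem_filter.1 hx).2
  have hc : (#{x ∈ X | x + (t - t₀) ∈ S} : ℝ) ≤ #S := by
    exact_mod_cast card_le_card_of_injOn (fun x ↦ x + (t - t₀))
      (fun x hx ↦ (mem_filter.1 hx).2) fun x _ y _ hxy ↦ by simpa using hxy
  have hgX : ∑ x ∈ X, g x ≤ 3 / 400 * #X := by
    rw [hg, ← sum_div, div_le_iff₀ hX']
    linarith
  have hfin : ∑ x ∈ X, g (x + (t - t₀)) ≤ 7 / 400 * #X := by linarith
  rw [hg, ← sum_div, div_le_iff₀ hX'] at hfin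
  linarith

end AlmostPeriods

section Spectral

variable {G : Type*} [Fintype G] [AddCommGroup G]

lemma sum_norm_sq_mul_apply (h : G → ℝ) (θ : G) :
    ∑ χ : AddChar G ℂ, ((‖∑ s, h s * χ s‖ ^ 2 : ℝ) : ℂ) * χ θ =
      Fintype.card G * (corr h θ : ℂ) := by
  have h1 : ∀ χ : AddChar G ℂ, ((‖∑ s, h s * χ s‖ ^ 2 : ℝ) : ℂ) * χ θ =
      ∑ s, ∑ t, (h s * h t : ℂ) * χ (s - t + θ) := by
    intro χ
    push_cast
    rw [← Complex.mul_conj', map_sum, sum_mul_sum, sum_mul]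
    refine sum_congr rfl fun s _ ↦ ?_
    rw [sum_mul]
    refine sum_congr rfl fun t _ ↦ ?_
    rw [AddChar.map_add_eq_mul, sub_eq_add_neg, AddChar.map_add_eq_mul, AddChar.map_neg_eq_conj,
      map_mul, Complex.conj_ofReal]
    ring
  simp_rw [h1]
  rw [sum_comm]
  simp_rw [sum_comm (s := (univ : Finset (AddChar G ℂ))), ← mul_sum, AddChar.sum_apply_eq_ite]
  rw [corr]
  push_cast
  rw [mul_sum]
  refine sum_congr rfl fun s _ ↦ ?_
  rw [sum_eq_single (θ + s)]
  · rw [if_pos (by abel)]; ring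
  · intro t _ ht
    rw [if_neg, mul_zero]
    intro h0
    apply ht
    rw [← sub_eq_zero, ← neg_eq_zero, ← h0]; abel
  · simp

/-- A normalized autocorrelation is an average of characters. -/
lemma exists_spectral_weights (h : G → ℝ) (h0 : 0 < corr h 0) :
    ∃ w : AddChar G ℂ → ℝ, (∀ χ, 0 ≤ w χ) ∧ ∑ χ, w χ = 1 ∧
      ∀ θ, corr h θ / corr h 0 = ∑ χ, w χ * (χ θ).re := by
  have hG : (0 : ℝ) < Fintype.card G := by exact_mod_cast Fintype.card_pos
  have key : ∀ θ, corr h θ / corr h 0 =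
      ∑ χ : AddChar G ℂ, ‖∑ s, h s * χ s‖ ^ 2 / (Fintype.card G * corr h 0) * (χ θ).re := by
    intro θ
    have h1 := congrArg Complex.re (sum_norm_sq_mul_apply h θ)
    rw [Complex.re_sum] at h1
    simp only [Complex.re_ofReal_mul] at h1
    rw [← Complex.ofReal_natCast, Complex.re_ofReal_mul, Complex.ofReal_re] at h1
    simp_rw [div_mul_eq_mul_div]
    rw [← sum_div, h1]
    field_simp
  refine ⟨_, fun χ ↦ by positivity, ?_, key⟩
  have := key 0
  rw [div_self h0.ne'] at this
  simpa using this.symm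

lemma exists_characters {φ : G → ℝ} {w : AddChar G ℂ → ℝ} (hw : ∀ χ, 0 ≤ w χ)
    (hw1 : ∑ χ, w χ = 1) (hφ : ∀ θ, φ θ = ∑ χ, w χ * (χ θ).re) {T Y : Finset G} (t₀ : G) {k : ℕ}
    (hk : 1 ≤ k) (hYT : #Y ≤ 2 ^ k * #T) (hTY : ∀ t ∈ T, t - t₀ ∈ Y) :
    ∃ Γ : Finset (AddChar G ℂ), #Γ ≤ 15360000 * k ∧ ∀ e, (∀ t ∈ T, t - t₀ + e ∈ Y) →
      (∀ χ ∈ Γ, ‖χ e - 1‖ ≤ 1 / 400) →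
      ∑ t ∈ T, φ (t - t₀) - 5 / 400 * #T ≤ ∑ t ∈ T, φ (t - t₀ + e) := by
  obtain ⟨m, hm⟩ : ∃ m, m = 15360000 * k := ⟨_, rfl⟩
  rw [← hm]
  have hm0 : (0 : ℝ) < m := by
    have : 0 < m := by omega
    exact_mod_cast this
  have hYT' : (#Y : ℝ) ≤ 2 ^ k * #T := by exact_mod_cast hYT
  have hre : ∀ (x : G) (χ : AddChar G ℂ), |(χ x).re| ≤ 1 := fun x χ ↦
    (Complex.abs_re_le_norm _).trans_eq (AddChar.norm_apply _ _)
  have h := sum_prod_mul_card_deviation_le hw hw1 Y (z := fun x χ ↦ (χ x).re) hre (m := m)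
    (by omega) (η := 1 / 400) (by norm_num)
  simp only [← hφ] at h
  have hexp : (1 / 400 : ℝ) ^ 2 * m / 8 = 12 * k := by rw [hm]; push_cast; ring
  rw [hexp] at h
  set g : (Fin m → AddChar G ℂ) → G → ℝ := fun a x ↦ (∑ i, (a i x).re) / m with hg
  set S : (Fin m → AddChar G ℂ) → Finset G := fun a ↦ {x ∈ Y | 1 / 400 < |g a x - φ x|} with hS
  have hbd : 2 * #Y * Real.exp (-(12 * k)) ≤ 1 / 800 * #T := by
    calc 2 * #Y * Real.exp (-(12 * k)) ≤ 2 * (2 ^ k * #T) * Real.exp (-(12 * k)) := by gcongr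
      _ = 2 * 2 ^ k * Real.exp (-(12 * k)) * #T := by ring
      _ ≤ _ := mul_le_mul_of_nonneg_right (two_mul_two_pow_mul_exp_le hk) (by positivity)
  have hprod : ∑ a : Fin m → AddChar G ℂ, ∏ i, w (a i) = 1 := by
    rw [← Fintype.sum_pow, hw1, one_pow]
  obtain ⟨a, ha⟩ : ∃ a, (#(S a) : ℝ) ≤ 1 / 800 * #T := by
    by_contra! hcon
    obtain ⟨a, -, ha⟩ := exists_lt_of_sum_lt (s := univ) (f := fun _ ↦ (0 : ℝ))
      (g := fun a : Fin m → AddChar G ℂ ↦ ∏ i, w (a i)) (by rw [hprod]; simp)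
    have h1 : ∑ a : Fin m → AddChar G ℂ, (∏ i, w (a i)) * (1 / 800 * #T : ℝ) <
        ∑ a : Fin m → AddChar G ℂ, (∏ i, w (a i)) * (#(S a) : ℝ) :=
      sum_lt_sum (fun b _ ↦ mul_le_mul_of_nonneg_left (hcon b).le (prod_nonneg fun i _ ↦ hw _))
        ⟨a, mem_univ _, mul_lt_mul_of_pos_left (hcon a) ha⟩
    rw [← sum_mul, hprod, one_mul] at h1
    linarith
  refine ⟨univ.image a, card_image_le.trans (by simp), fun e heY he ↦ ?_⟩
  have hge : ∀ x, g a x - 1 / 400 ≤ g a (x + e) := by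
    intro x
    rw [hg, sub_le_iff_le_add, div_le_iff₀ hm0, add_mul, div_mul_cancel₀ _ hm0.ne']
    have : ∑ i, (a i x).re ≤ ∑ i : Fin m, ((a i (x + e)).re + 1 / 400) := by
      refine sum_le_sum fun i _ ↦ ?_
      have h1 := he (a i) (mem_image_of_mem _ (mem_univ i))
      have h2 := norm_addChar_sub (a i) (x + e) x
      rw [add_sub_cancel_left] at h2
      have h3 := (Complex.abs_re_le_norm (a i (x + e) - a i x)).trans (h2.le.trans h1)
      rw [Complex.sub_re] at h3
      linarith [(abs_le.1 h3).1]
    rw [sum_add_distrib, sum_const, card_univ, Fintype.card_fin, nsmul_eq_mul] at this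
    linarith
  have hg1 : ∀ x, |g a x| ≤ 1 := by
    intro x
    rw [hg, abs_div, abs_of_pos hm0, div_le_one hm0]
    exact (abs_sum_le_sum_abs _ _).trans ((sum_le_sum fun i _ ↦ hre x (a i)).trans_eq (by simp))
  have hφ1 : ∀ x, |φ x| ≤ 1 := by
    intro x
    rw [hφ, ← hw1]
    refine (abs_sum_le_sum_abs _ _).trans (sum_le_sum fun χ _ ↦ ?_)
    rw [abs_mul, abs_of_nonneg (hw χ)]
    exact mul_le_of_le_one_right (hw χ) (hre x χ)
  have hdev : ∀ x ∈ Y, |g a x - φ x| ≤ 1 / 400 + 2 * if x ∈ S a then 1 else 0 := by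
    intro x hx
    split_ifs with hxS
    · exact (abs_sub _ _).trans (by linarith [hg1 x, hφ1 x])
    · have := not_lt.1 fun hlt ↦ hxS (mem_filter.2 ⟨hx, hlt⟩)
      linarith
  have hpt : ∀ t ∈ T, φ (t - t₀) ≤ φ (t - t₀ + e) + 3 / 400 +
      2 * (if t - t₀ ∈ S a then 1 else 0) + 2 * (if t - t₀ + e ∈ S a then 1 else 0) := by
    intro t ht
    have h1 := (abs_le.1 (hdev _ (hTY t ht))).1
    have h2 := (abs_le.1 (hdev _ (heY t ht))).2
    have h3 := hge (t - t₀)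
    linarith
  have hsum := sum_le_sum hpt
  rw [sum_add_distrib, sum_add_distrib, sum_add_distrib, ← mul_sum, ← mul_sum, sum_boole,
    sum_boole, sum_const, nsmul_eq_mul] at hsum
  have hc₁ : (#{t ∈ T | t - t₀ ∈ S a} : ℝ) ≤ #(S a) := by
    exact_mod_cast card_le_card_of_injOn (fun t ↦ t - t₀)
      (fun t ht ↦ (mem_filter.1 ht).2) fun x _ y _ hxy ↦ by simpa using hxy
  have hc₂ : (#{t ∈ T | t - t₀ + e ∈ S a} : ℝ) ≤ #(S a) := by
    exact_mod_cast card_le_card_of_injOn (fun t ↦ t - t₀ + e)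
      (fun t ht ↦ (mem_filter.1 ht).2) fun x _ y _ hxy ↦ by simpa using hxy
  linarith

end Spectral

section Translate

lemma le_sum_sum_of_card_lt {ι : Type*} {X : Finset ι} {g : ι → ι → ℝ} (hg : ∀ x y, 0 ≤ g x y)
    {c : ℝ} (hc : 0 ≤ c) {η : ℝ} (h : ∑ x ∈ X, (#{y ∈ X | g x y < c} : ℝ) ≤ η * (#X : ℝ) ^ 2) :
    (1 - η) * c * (#X : ℝ) ^ 2 ≤ ∑ x ∈ X, ∑ y ∈ X, g x y := by
  have h1 : ∀ x ∈ X, c * #X - c * (#{y ∈ X | g x y < c} : ℝ) ≤ ∑ y ∈ X, g x y := by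
    intro x _
    rw [← sum_boole, mul_comm c (#X : ℝ), ← nsmul_eq_mul, ← sum_const, mul_sum, ← sum_sub_distrib]
    refine sum_le_sum fun y _ ↦ ?_
    split_ifs with hxy
    · have := hg x y; linarith
    · have := not_lt.1 hxy; linarith
  have h2 := sum_le_sum h1
  rw [sum_sub_distrib, sum_const, nsmul_eq_mul, ← mul_sum] at h2
  have h3 := mul_le_mul_of_nonneg_left h hc
  linarith

variable {G : Type*} [Fintype G] [AddCommGroup G]

lemma corr_sum_translate (A X : Finset G) (θ : G) :
    corr (fun s ↦ ∑ x ∈ X, ind A (x + s)) θ =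
      ∑ x ∈ X, ∑ y ∈ X, corr (ind A) (x + θ - y) := by
  simp_rw [corr_sub]
  rw [corr]
  simp_rw [sum_mul_sum]
  rw [sum_comm]
  refine sum_congr rfl fun x _ ↦ ?_
  rw [sum_comm]
  simp_rw [add_assoc]

lemma sum_corr_add_le {A E : Finset G} {c : ℝ}
    (hc : ∀ z, (#{e ∈ E | z + e ∈ A} : ℝ) ≤ c) (u : G) :
    ∑ e ∈ E, corr (ind A) (u + e) ≤ c * #A := by
  simp_rw [corr]
  rw [sum_comm, ← sum_ind A, mul_sum]
  refine sum_le_sum fun s _ ↦ ?_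
  rw [← sum_mul]
  refine mul_le_mul_of_nonneg_right ?_ (ind_nonneg A s)
  refine le_trans (le_of_eq ?_) (hc (u + s))
  rw [← sum_boole]
  refine sum_congr rfl fun e _ ↦ ?_
  rw [ind, add_right_comm]

/-- If the autocorrelation of `A` is nearly constant and large along many translates, then `A` has
increased density on a translate of every set that the relevant characters nearly annihilate. -/
lemma exists_translate_dense {A X T Y : Finset G} {b M : ℝ} {t₀ : G} {k : ℕ} (hk : 1 ≤ k)
    (hX : X.Nonempty) (ht₀ : t₀ ∈ T) (hA : 0 < #A) (hb : 0 < b)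
    (hM : 1.12 * ((#A : ℝ) ^ 2 / b) ≤ M)
    (hup : ∑ x ∈ X, ∑ y ∈ X, corr (ind A) (x - y) ≤ (1 + 2 / 400) * M * (#X : ℝ) ^ 2)
    (hlow : ∀ t ∈ T, ∑ x ∈ X, (#{y ∈ X | corr (ind A) (x + (t - t₀) - y) < (1 - 1 / 400) * M} : ℝ) ≤
      7 / 400 * (#X : ℝ) ^ 2)
    (hYT : #Y ≤ 2 ^ k * #T) (hTY : ∀ t ∈ T, t - t₀ ∈ Y) :
    ∃ Γ : Finset (AddChar G ℂ), #Γ ≤ 15360000 * k ∧ ∀ E : Finset G, E.Nonempty →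
      (∀ e ∈ E, ∀ t ∈ T, t - t₀ + e ∈ Y) → (∀ e ∈ E, ∀ χ ∈ Γ, ‖χ e - 1‖ ≤ 1 / 400) →
      ∃ z, 1.055 * (#A / b) * #E ≤ (#{e ∈ E | z + e ∈ A} : ℝ) := by
  have hX0 : (0 : ℝ) < #X := by exact_mod_cast hX.card_pos
  have hA0 : (0 : ℝ) < #A := by exact_mod_cast hA
  have hT0 : (0 : ℝ) < #T := by exact_mod_cast card_pos.2 ⟨t₀, ht₀⟩
  have hab : (0 : ℝ) < (#A : ℝ) ^ 2 / b := by positivity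
  have hM0 : 0 < M := by linarith
  have hMX : 0 < M * (#X : ℝ) ^ 2 := by positivity
  set h : G → ℝ := fun s ↦ ∑ x ∈ X, ind A (x + s) with hh
  have hlow' : ∀ t ∈ T, (1 - 7 / 400) * ((1 - 1 / 400) * M) * (#X : ℝ) ^ 2 ≤ corr h (t - t₀) := by
    intro t ht
    rw [hh, corr_sum_translate]
    exact le_sum_sum_of_card_lt (fun _ _ ↦ corr_ind_nonneg _ _) (by linarith) (hlow t ht)
  have hup' : corr h 0 ≤ (1 + 2 / 400) * M * (#X : ℝ) ^ 2 := by
    rw [hh, corr_sum_translate]; simpa using hup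
  have hlow0 : (1 - 7 / 400) * ((1 - 1 / 400) * M) * (#X : ℝ) ^ 2 ≤ corr h 0 := by
    simpa using hlow' t₀ ht₀
  have h0 : 0 < corr h 0 := by linarith
  obtain ⟨w, hw, hw1, hφ⟩ := exists_spectral_weights h h0
  obtain ⟨Γ, hΓ, hΓe⟩ := exists_characters hw hw1 hφ t₀ hk hYT hTY
  refine ⟨Γ, hΓ, fun E hE hEY hEΓ ↦ ?_⟩
  by_contra! hcon
  have hE0 : (0 : ℝ) < #E := by exact_mod_cast hE.card_pos
  have hφt : ∀ t ∈ T, 1 - 10 / 400 ≤ corr h (t - t₀) / corr h 0 := by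
    intro t ht
    rw [le_div_iff₀ h0]
    have := hlow' t ht
    linarith
  have hφT : (1 - 10 / 400) * #T ≤ ∑ t ∈ T, corr h (t - t₀) / corr h 0 := by
    rw [mul_comm, ← nsmul_eq_mul]; exact card_nsmul_le_sum _ _ _ hφt
  have hsumE : ∀ e ∈ E, (1 - 15 / 400) * #T ≤ ∑ t ∈ T, corr h (t - t₀ + e) / corr h 0 := by
    intro e he
    have := hΓe e (hEY e he) (hEΓ e he)
    linarith
  have hsum : (#E : ℝ) * ((1 - 15 / 400) * #T) ≤
      ∑ t ∈ T, ∑ e ∈ E, corr h (t - t₀ + e) / corr h 0 := by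
    rw [sum_comm, ← nsmul_eq_mul]; exact card_nsmul_le_sum _ _ _ hsumE
  have hupper : ∀ θ, ∑ e ∈ E, corr h (θ + e) ≤
      (#X : ℝ) ^ 2 * (1.055 * (#A / b) * #E * #A) := by
    intro θ
    simp_rw [hh, corr_sum_translate]
    rw [sum_comm]
    have h1 : ∀ x ∈ X, ∑ e ∈ E, ∑ y ∈ X, corr (ind A) (x + (θ + e) - y) ≤
        #X * (1.055 * (#A / b) * #E * #A) := by
      intro x _
      rw [sum_comm, ← nsmul_eq_mul]
      refine sum_le_card_nsmul _ _ _ fun y _ ↦ ?_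
      have := sum_corr_add_le (fun z ↦ (hcon z).le) (x + θ - y)
      refine le_trans (le_of_eq ?_) this
      refine sum_congr rfl fun e _ ↦ congrArg _ (by abel)
    refine (sum_le_card_nsmul _ _ _ h1).trans_eq ?_
    rw [nsmul_eq_mul]; ring
  have hsum2 : ∑ t ∈ T, ∑ e ∈ E, corr h (t - t₀ + e) / corr h 0 ≤
      #T * ((#X : ℝ) ^ 2 * (1.055 * (#A / b) * #E * #A) / corr h 0) := by
    rw [← nsmul_eq_mul]
    refine sum_le_card_nsmul _ _ _ fun t _ ↦ ?_
    rw [← sum_div]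
    exact div_le_div_of_nonneg_right (hupper _) h0.le
  have h3 := hsum.trans hsum2
  rw [mul_div_assoc', le_div_iff₀ h0] at h3
  have h4 : #E * ((1 - 15 / 400) * #T) * corr h 0 ≥
      #E * ((1 - 15 / 400) * #T) * ((1 - 7 / 400) * ((1 - 1 / 400) * (1.12 * ((#A : ℝ) ^ 2 / b)))
        * (#X : ℝ) ^ 2) := by
    refine mul_le_mul_of_nonneg_left (le_trans ?_ hlow0) (by positivity)
    refine mul_le_mul_of_nonneg_right ?_ (by positivity)
    linarith
  have h5 : (#E : ℝ) * ((1 - 15 / 400) * #T) * ((1 - 7 / 400) * ((1 - 1 / 400) *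
      (1.12 * ((#A : ℝ) ^ 2 / b))) * (#X : ℝ) ^ 2) =
      ((1 - 15 / 400) * (1 - 7 / 400) * (1 - 1 / 400) * 1.12) *
        (#E * #T * #X ^ 2 * ((#A : ℝ) ^ 2 / b)) := by ring
  have h6 : (#T : ℝ) * ((#X : ℝ) ^ 2 * (1.055 * (#A / b) * #E * #A)) =
      1.055 * (#E * #T * #X ^ 2 * ((#A : ℝ) ^ 2 / b)) := by ring
  have h7 : (0 : ℝ) < #E * #T * #X ^ 2 * ((#A : ℝ) ^ 2 / b) := by positivity
  rw [h6] at h3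
  rw [h5] at h4
  have h8 : (1.055 : ℝ) < (1 - 15 / 400) * (1 - 7 / 400) * (1 - 1 / 400) * 1.12 := by norm_num
  have := mul_lt_mul_of_pos_right h8 h7
  linarith

end Translate

section Increment

variable {G : Type*} [AddCommGroup G]

/-- The image of a finite set under doubling. -/
noncomputable def dbl (S : Finset G) : Finset G := S.image fun x ↦ x + x

lemma mem_dbl {S : Finset G} {x : G} : x ∈ dbl S ↔ ∃ y ∈ S, y + y = x := mem_image

lemma card_dbl (h2 : Function.Injective fun x : G ↦ x + x) (S : Finset G) : #(dbl S) = #S :=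
  card_image_of_injective _ h2

variable [Fintype G]

lemma dbl_bohrSet_subset (Γ : Finset (AddChar G ℂ)) (r : ℝ) :
    dbl (bohrSet Γ r) ⊆ bohrSet Γ (2 * r) := by
  intro x hx
  obtain ⟨y, hy, rfl⟩ := mem_dbl.1 hx
  rw [two_mul]
  exact add_mem_bohrSet hy hy

lemma add_mem_dbl_bohrSet {Γ : Finset (AddChar G ℂ)} {r s : ℝ} {x y : G}
    (hx : x ∈ dbl (bohrSet Γ r)) (hy : y ∈ dbl (bohrSet Γ s)) :
    x + y ∈ dbl (bohrSet Γ (r + s)) := by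
  obtain ⟨a, ha, rfl⟩ := mem_dbl.1 hx
  obtain ⟨b, hb, rfl⟩ := mem_dbl.1 hy
  exact mem_dbl.2 ⟨a + b, add_mem_bohrSet ha hb, by abel⟩

lemma sub_mem_dbl_bohrSet {Γ : Finset (AddChar G ℂ)} {r s : ℝ} {x y : G}
    (hx : x ∈ dbl (bohrSet Γ r)) (hy : y ∈ dbl (bohrSet Γ s)) :
    x - y ∈ dbl (bohrSet Γ (r + s)) := by
  obtain ⟨a, ha, rfl⟩ := mem_dbl.1 hx
  obtain ⟨b, hb, rfl⟩ := mem_dbl.1 hy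
  exact mem_dbl.2 ⟨a - b, sub_mem_bohrSet ha hb, by abel⟩

lemma dbl_bohrSet_mono {Γ : Finset (AddChar G ℂ)} {r s : ℝ} (h : r ≤ s) :
    dbl (bohrSet Γ r) ⊆ dbl (bohrSet Γ s) := image_subset_image (bohrSet_mono h)

lemma BohrRegular.card_le {d : ℕ} {Γ : Finset (AddChar G ℂ)} {r : ℝ} (h : BohrRegular d Γ r) :
    #(bohrSet Γ ((1 + 1 / (1000 * d)) * r)) ≤ 2 * #(bohrSet Γ r) := by
  have h' : (#(bohrSet Γ ((1 + 1 / (1000 * d)) * r)) : ℝ) ≤ 1.01 * #(bohrSet Γ r) := h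
  have : (#(bohrSet Γ ((1 + 1 / (1000 * d)) * r)) : ℝ) ≤ (2 * #(bohrSet Γ r) : ℕ) := by
    push_cast
    have : (0 : ℝ) ≤ #(bohrSet Γ r) := by positivity
    linarith
  exact_mod_cast this

/-- If `A₁` and `A₂` are dense subsets of regular Bohr sets, the second one much narrower, and no
element of `A₂` is the midpoint of two elements of `A₁` other than itself, then `A₁` has increased
density along a doubled Bohr set of controlled rank. -/
lemma exists_dense_translate_of_no_midpoints (h2 : Function.Injective fun x : G ↦ x + x)
    {Γ : Finset (AddChar G ℂ)} {d l : ℕ} {κ r₁ r₂ r₃ r₄ : ℝ} (hκ : κ = 1 / (1000 * d))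
    (hr₂ : 0 < r₂) (hr₃ : 0 < r₃) (hr₄ : 0 < r₄) (h₁₂ : 2 * r₂ ≤ κ * r₁)
    (h₁₃ : 4 * r₃ ≤ κ * r₁) (h₂₃ : 2 * r₃ ≤ κ * r₂) (h₃₄ : 2 * r₄ ≤ κ * r₃)
    (hreg₃ : BohrRegular d Γ r₃) (hreg₄ : BohrRegular d Γ r₄) {A₁ A₂ : Finset G}
    (hA₁ : A₁ ⊆ bohrSet Γ r₁) (hA₂ : A₂ ⊆ bohrSet Γ r₂)
    (hfree : ∀ a ∈ A₁, ∀ b ∈ A₂, ∀ c ∈ A₁, a + c = b + b → a = b)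
    (hd₁ : #(bohrSet Γ ((1 + κ) * r₁)) ≤ 2 ^ (l + 1) * #A₁)
    (hd₂ : #(bohrSet Γ ((1 + κ) * r₂)) ≤ 2 ^ (l + 1) * #A₂)
    (hbig : 4 * #(bohrSet Γ ((1 + κ) * r₁)) ≤ #A₁ ^ 2) :
    ∃ Γ' : Finset (AddChar G ℂ),
      #Γ' ≤ 15360000 * (15360001 * (1920017 * (l + 1) ^ 2 + 1) ^ 2 + 1) ∧
      ∀ r₅, 0 ≤ r₅ → r₅ ≤ 1 / 800 → r₅ ≤ κ * r₄ →
        ∃ z, 1.055 * ((#A₁ : ℝ) / #(bohrSet Γ ((1 + κ) * r₁))) * #(bohrSet (Γ ∪ Γ') r₅) ≤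
          (#{b ∈ bohrSet (Γ ∪ Γ') r₅ | z + (b + b) ∈ A₁} : ℝ) := by
  have hκ0 : 0 ≤ κ := by rw [hκ]; positivity
  have hκr₂ : 0 ≤ κ * r₂ := by positivity
  have hκr₁ : 0 ≤ κ * r₁ := by linarith
  have hr₂' : 0 ≤ (1 + κ) * r₂ := by positivity
  have hpos₂ : 0 < #A₂ := by
    have := card_bohrSet_pos (Γ := Γ) hr₂'
    by_contra! h
    rw [Nat.le_zero.1 h] at hd₂
    omega
  obtain ⟨B, hB⟩ : ∃ B, B = bohrSet Γ ((1 + κ) * r₁) := ⟨_, rfl⟩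
  rw [← hB] at hd₁ hbig ⊢
  have hmemB : ∀ {s : ℝ} {x : G}, s ≤ κ * r₁ → x ∈ bohrSet Γ (r₁ + s) → x ∈ B := by
    intro s x hs hx
    rw [hB]
    exact bohrSet_mono (by linarith) hx
  have hpos₁ : 0 < #A₁ := by
    by_contra! h
    rw [Nat.le_zero.1 h] at hd₁ hbig
    have : 0 < #B := by
      obtain ⟨a, ha⟩ := card_pos.1 hpos₂
      have : (0 : G) ∈ bohrSet Γ (r₁ + κ * r₁) := by
        rcases le_or_gt 0 r₁ with h | h
        · exact zero_mem_bohrSet (by linarith)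
        · have : κ * r₁ ≤ 0 := mul_nonpos_of_nonneg_of_nonpos hκ0 h.le
          linarith
      exact card_pos.2 ⟨0, hmemB le_rfl this⟩
    omega
  have hBpos : 0 < #B := by
    obtain ⟨a, ha⟩ := card_pos.1 hpos₁
    refine card_pos.2 ⟨a, hmemB hκr₁ ?_⟩
    exact bohrSet_mono (by linarith) (hA₁ ha)
  set D := dbl (bohrSet Γ r₃) with hD
  have hDpos : 0 < #D := by rw [hD, card_dbl h2]; exact card_bohrSet_pos hr₃.le
  have hDsub := dbl_bohrSet_subset Γ r₃
  have hmom := sum_corr_pow_ge (A := A₁) (B := B) (C := dbl A₂) (D := D)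
    (Y := dbl (bohrSet Γ ((1 + κ) * r₂))) (l := l) hpos₁
    (fun x hx y hy a ha ↦ hmemB (s := 2 * r₃ + 2 * r₃) (by linarith) (by
      rw [← add_assoc]
      exact sub_mem_bohrSet (add_mem_bohrSet (hA₁ ha) (hDsub hx)) (hDsub hy)))
    (fun c hc a ha ↦ hmemB (s := 2 * r₂) h₁₂ (by
      rw [add_comm]
      exact sub_mem_bohrSet (dbl_bohrSet_subset Γ r₂ (image_subset_image hA₂ hc)) (hA₁ ha)))
    (fun c hc ↦ by
      obtain ⟨b, hb, rfl⟩ := mem_dbl.1 hc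
      refine card_le_one.2 fun x hx y hy ↦ ?_
      rw [mem_filter] at hx hy
      rw [hfree x hx.1 b hb _ hx.2 (by abel), hfree y hy.1 b hb _ hy.2 (by abel)])
    hbig hBpos
    (fun c hc x hx y hy ↦ dbl_bohrSet_mono (by linarith) (sub_mem_dbl_bohrSet
      (add_mem_dbl_bohrSet (image_subset_image hA₂ hc) hx) hy))
    (by rwa [card_dbl h2, card_dbl h2]) (by rwa [card_dbl h2])
  obtain ⟨X, hXD, M, hM, hX, hXcard, hup, hbad⟩ := exists_sifted (L := l + 1) (by omega) hpos₁ hDpos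
    (fun x hx a ha ↦ hmemB (s := 2 * r₃) (by linarith) (sub_mem_bohrSet (hA₁ ha) (hDsub hx)))
    hd₁ hmom
  obtain ⟨k, hk⟩ : ∃ k, k = 1920017 * (l + 1) ^ 2 + 1 := ⟨_, rfl⟩
  rw [← hk]
  have hk1 : 1 ≤ k := by omega
  have hD'pos : 0 < #(dbl (bohrSet Γ r₄)) := by rw [card_dbl h2]; exact card_bohrSet_pos hr₄.le
  have hXY : #(dbl (bohrSet Γ ((1 + κ) * r₃))) ≤ 2 ^ k * #X := by
    have h1 : #D ≤ 2 ^ (1920017 * (l + 1) ^ 2) * #X := by exact_mod_cast hXcard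
    have h3 := hreg₃.card_le
    rw [← hκ] at h3
    rw [card_dbl h2, hk, pow_succ]
    rw [hD, card_dbl h2] at h1
    calc _ ≤ 2 * #(bohrSet Γ r₃) := h3
      _ ≤ 2 * (2 ^ (1920017 * (l + 1) ^ 2) * #X) := Nat.mul_le_mul_left _ h1
      _ = _ := by rw [← mul_assoc, mul_comm 2]
  obtain ⟨T, hTD, t₀, ht₀, hTcard, hT⟩ := exists_almost_periods (D := dbl (bohrSet Γ r₄)) hk1 hX
    (card_pos.1 hD'pos)
    (fun x hx t ht ↦ dbl_bohrSet_mono (by linarith) (sub_mem_dbl_bohrSet (hXD hx) ht))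
    (fun x hx t ht t' ht' ↦ dbl_bohrSet_mono (by linarith)
      (add_mem_dbl_bohrSet (hXD hx) (sub_mem_dbl_bohrSet ht ht'))) hXY hXY
    (fun u ↦ corr (ind A₁) u < (1 - 1 / 400) * M) hbad
  obtain ⟨k', hk'⟩ : ∃ k', k' = 15360001 * k ^ 2 + 1 := ⟨_, rfl⟩
  rw [← hk']
  set Y := (dbl (bohrSet Γ ((1 + κ) * r₄))).image fun x ↦ x - t₀ with hY
  have hYT : #Y ≤ 2 ^ k' * #T := by
    have h1 : #(dbl (bohrSet Γ r₄)) ≤ 2 ^ (15360001 * k ^ 2) * #T := by exact_mod_cast hTcard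
    have h3 := hreg₄.card_le
    rw [← hκ] at h3
    rw [card_dbl h2] at h1
    rw [hk', pow_succ]
    calc #Y ≤ #(bohrSet Γ ((1 + κ) * r₄)) := card_image_le.trans_eq (card_dbl h2 _)
      _ ≤ 2 * #(bohrSet Γ r₄) := h3
      _ ≤ 2 * (2 ^ (15360001 * k ^ 2) * #T) := Nat.mul_le_mul_left _ h1
      _ = _ := by rw [← mul_assoc, mul_comm 2]
  have hYmem : ∀ {s : ℝ} {x : G}, s ≤ κ * r₄ → x ∈ dbl (bohrSet Γ (r₄ + s)) → x - t₀ ∈ Y :=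
    fun hs hx ↦ mem_image_of_mem _ (dbl_bohrSet_mono (by linarith) hx)
  obtain ⟨Γ', hΓ', hz⟩ := exists_translate_dense (b := (#B : ℝ)) (k := k') (by omega) hX ht₀ hpos₁
    (by exact_mod_cast hBpos) hM hup hT hYT
    (fun t ht ↦ hYmem (s := 0) (by positivity) (by rw [add_zero]; exact hTD ht))
  refine ⟨Γ', hΓ', fun r₅ h0 h800 hr₅ ↦ ?_⟩
  have hsub : dbl (bohrSet (Γ ∪ Γ') r₅) ⊆ dbl (bohrSet Γ r₅) :=
    image_subset_image (bohrSet_anti subset_union_left)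
  obtain ⟨z, hz⟩ := hz (dbl (bohrSet (Γ ∪ Γ') r₅))
    (card_pos.1 (by rw [card_dbl h2]; exact card_bohrSet_pos h0))
    (fun e he t ht ↦ by
      rw [sub_add_eq_add_sub]
      exact hYmem hr₅ (add_mem_dbl_bohrSet (hTD ht) (hsub he)))
    (fun e he χ hχ ↦ (mem_bohrSet.1 (dbl_bohrSet_subset _ _ he) χ
      (mem_union_right _ hχ)).trans (by linarith))
  refine ⟨z, ?_⟩
  rw [card_dbl h2] at hz
  refine hz.trans ?_
  have : {e ∈ dbl (bohrSet (Γ ∪ Γ') r₅) | z + e ∈ A₁} ⊆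
      {b ∈ bohrSet (Γ ∪ Γ') r₅ | z + (b + b) ∈ A₁}.image fun b ↦ b + b := by
    intro e he
    rw [mem_filter] at he
    obtain ⟨b, hb, rfl⟩ := mem_dbl.1 he.1
    exact mem_image_of_mem _ (mem_filter.2 ⟨hb, he.2⟩)
  exact_mod_cast (card_le_card this).trans card_image_le

end Increment

section Step

lemma four_mul_le_sq_of_dense {a b c p α : ℝ} (hα : 0 ≤ α) (hb : 0 ≤ b) (hc : c ≤ 1.01 * b)
    (ha : 0.97 * α * b ≤ a) (hp : 8 * p ^ 2 ≤ b) (hpα : 1 ≤ p * α) : 4 * c ≤ a ^ 2 := by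
  have h1 : (0.97 * α * b) ^ 2 ≤ a ^ 2 := pow_le_pow_left₀ (by positivity) ha 2
  have h2 := mul_le_mul_of_nonneg_right hp (by positivity : (0 : ℝ) ≤ α ^ 2 * b)
  have h3 := mul_le_mul_of_nonneg_right (one_le_pow₀ hpα : 1 ≤ (p * α) ^ 2) hb
  linarith

variable {G : Type*} [AddCommGroup G]

lemma sum_card_translate {A P S : Finset G} (h : ∀ a ∈ A, ∀ y ∈ S, a - y ∈ P) :
    ∑ x ∈ P, #{y ∈ S | x + y ∈ A} = #A * #S := by
  simp_rw [card_filter]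
  rw [sum_comm, mul_comm, ← smul_eq_mul]
  refine sum_eq_card_nsmul fun y hy ↦ ?_
  rw [← card_filter]
  refine card_bij (fun x _ ↦ x + y) (fun x hx ↦ (mem_filter.1 hx).2)
    (fun _ _ _ _ hxy ↦ add_right_cancel hxy) fun a ha ↦ ⟨a - y, ?_, sub_add_cancel a y⟩
  rw [mem_filter, sub_add_cancel]
  exact ⟨h a ha y hy, ha⟩

lemma exists_translate_dense_or {A B P S₁ S₂ : Finset G} {α : ℝ} (hα : 0 ≤ α)
    (hA : α * #B ≤ #A) (hP : (#P : ℝ) ≤ 1.01 * #B) (hP0 : P.Nonempty)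
    (h₁ : ∀ a ∈ A, ∀ y ∈ S₁, a - y ∈ P) (h₂ : ∀ a ∈ A, ∀ y ∈ S₂, a - y ∈ P)
    (hS₁ : 0 < #S₁) (hS₂ : 0 < #S₂) :
    ∃ x, (1.01 * α * #S₁ ≤ #{y ∈ S₁ | x + y ∈ A}) ∨ (1.01 * α * #S₂ ≤ #{y ∈ S₂ | x + y ∈ A}) ∨
      (0.97 * α * #S₁ ≤ #{y ∈ S₁ | x + y ∈ A} ∧ 0.97 * α * #S₂ ≤ #{y ∈ S₂ | x + y ∈ A}) := by
  have hS₁' : (0 : ℝ) < #S₁ := by exact_mod_cast hS₁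
  have hS₂' : (0 : ℝ) < #S₂ := by exact_mod_cast hS₂
  have e₁ : ∑ x ∈ P, (#{y ∈ S₁ | x + y ∈ A} : ℝ) = #A * #S₁ := by
    exact_mod_cast sum_card_translate h₁
  have e₂ : ∑ x ∈ P, (#{y ∈ S₂ | x + y ∈ A} : ℝ) = #A * #S₂ := by
    exact_mod_cast sum_card_translate h₂
  have hsum : ∑ x ∈ P, ((#{y ∈ S₁ | x + y ∈ A} : ℝ) / #S₁ + (#{y ∈ S₂ | x + y ∈ A} : ℝ) / #S₂) =
      2 * #A := by
    rw [sum_add_distrib, ← sum_div, ← sum_div, e₁, e₂, mul_div_cancel_right₀ _ hS₁'.ne',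
      mul_div_cancel_right₀ _ hS₂'.ne', two_mul]
  have hle : ∑ x ∈ P, 1.98 * α ≤
      ∑ x ∈ P, ((#{y ∈ S₁ | x + y ∈ A} : ℝ) / #S₁ + (#{y ∈ S₂ | x + y ∈ A} : ℝ) / #S₂) := by
    rw [hsum, sum_const, nsmul_eq_mul]
    have h3 : α * #P ≤ α * (1.01 * #B) := mul_le_mul_of_nonneg_left hP hα
    have h4 : (0 : ℝ) ≤ α * #B := by positivity
    linarith
  obtain ⟨x, -, hx⟩ := exists_le_of_sum_le hP0 hle
  refine ⟨x, ?_⟩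
  simp only [← le_div_iff₀ hS₁', ← le_div_iff₀ hS₂']
  by_contra! hcon
  obtain ⟨c₁, c₂, c₃⟩ := hcon
  have := c₃ (by linarith)
  linarith

lemma ThreeAPFree.translate_filter {A S : Finset G} (hA : ThreeAPFree (A : Set G)) (x : G) :
    ThreeAPFree (({y ∈ S | x + y ∈ A} : Finset G) : Set G) := by
  intro a ha b hb c hc h
  rw [mem_coe, mem_filter] at ha hb hc
  refine add_left_cancel (hA ha.2 hb.2 hc.2 (?_ : x + a + (x + c) = x + b + (x + b)))
  rw [add_add_add_comm, h, add_add_add_comm]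

lemma ThreeAPFree.dilate_filter {A S : Finset G} (h2 : Function.Injective fun x : G ↦ x + x)
    (hA : ThreeAPFree (A : Set G)) (x : G) :
    ThreeAPFree (({y ∈ S | x + (y + y) ∈ A} : Finset G) : Set G) := by
  intro a ha b hb c hc h
  rw [mem_coe, mem_filter] at ha hb hc
  refine h2 (add_left_cancel (hA ha.2 hb.2 hc.2
    (?_ : x + (a + a) + (x + (c + c)) = x + (b + b) + (x + (b + b)))))
  rw [add_add_add_comm, add_add_add_comm a, h, add_add_add_comm x (b + b)]

variable [Fintype G]

lemma BohrRegular.mono {d d' : ℕ} {Γ : Finset (AddChar G ℂ)} {r : ℝ} (h : BohrRegular d Γ r)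
    (hr : 0 ≤ r) (hd : 1 ≤ d) (hdd : d ≤ d') : BohrRegular d' Γ r := by
  have hd0 : (0 : ℝ) < d := by exact_mod_cast hd
  have hdd' : (d : ℝ) ≤ d' := by exact_mod_cast hdd
  refine le_trans ?_ h
  exact_mod_cast card_le_card (bohrSet_mono (by gcongr))

/-- The density increment step. -/
lemma exists_density_increment (h2 : Function.Injective fun x : G ↦ x + x) {K : ℕ}
    (hK : ∀ l : ℕ, 15360000 * (15360001 * (1920017 * (l + 1) ^ 2 + 1) ^ 2 + 1) ≤ K * (l + 1) ^ 4)
    {Γ : Finset (AddChar G ℂ)} {d l : ℕ} {r α : ℝ} (hd : 1 ≤ d) (hΓ : #Γ ≤ d) (hr : 0 < r)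
    (hr2 : r ≤ 2) (hreg : BohrRegular d Γ r) {A : Finset G} (hA : A ⊆ bohrSet Γ r)
    (hfree : ThreeAPFree (A : Set G)) (hdens : α * #(bohrSet Γ r) ≤ #A) (hα : 1 ≤ 2 ^ l * α)
    (hbig : 8 * (2 ^ l) ^ 2 ≤ (#(bohrSet Γ (1 / (1000 * d) * r / 2)) : ℝ)) :
    ∃ (Γ' : Finset (AddChar G ℂ)) (r' : ℝ) (A' : Finset G), #Γ' ≤ d + K * (l + 1) ^ 4 ∧
      (1 / (1000 * d)) ^ 5 / 256 * r ≤ r' ∧ r' ≤ 2 ∧ BohrRegular (d + K * (l + 1) ^ 4) Γ' r' ∧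
      A' ⊆ bohrSet Γ' r' ∧ ThreeAPFree (A' : Set G) ∧ 1.01 * α * #(bohrSet Γ' r') ≤ #A' := by
  have hd0 : (1 : ℝ) ≤ d := by exact_mod_cast hd
  have hα0 : 0 < α := by
    by_contra! h
    have : 2 ^ l * α ≤ 0 := mul_nonpos_of_nonneg_of_nonpos (by positivity) h
    linarith
  obtain ⟨κ, hκ⟩ : ∃ κ : ℝ, κ = 1 / (1000 * d) := ⟨_, rfl⟩
  have hκ0 : 0 < κ := by rw [hκ]; positivity
  have hκ1 : κ ≤ 1 / 1000 := by
    rw [hκ]; exact one_div_le_one_div_of_le (by norm_num) (by linarith)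
  rw [← hκ] at hbig ⊢
  have hκmul : ∀ {s : ℝ}, 0 < s → 0 < κ * s ∧ κ * s ≤ s / 1000 := fun {s} hs ↦
    ⟨mul_pos hκ0 hs, by
      have := mul_le_mul_of_nonneg_right hκ1 hs.le
      linarith⟩
  have hκle : ∀ {s t : ℝ}, s ≤ t → κ * s ≤ κ * t := fun h ↦ mul_le_mul_of_nonneg_left h hκ0.le
  have hr' := hκmul hr
  obtain ⟨r₁, hl₁, hu₁, hreg₁⟩ := exists_bohrRegular hd hΓ hr'.1
  have hr₁ : 0 < r₁ := by linarith
  have hr₁' := hκmul hr₁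
  obtain ⟨r₂, hl₂, hu₂, hreg₂⟩ := exists_bohrRegular hd hΓ (half_pos hr₁'.1)
  have hr₂ : 0 < r₂ := by linarith
  have hr₂' := hκmul hr₂
  obtain ⟨r₃, hl₃, hu₃, hreg₃⟩ := exists_bohrRegular hd hΓ (half_pos hr₂'.1)
  have hr₃ : 0 < r₃ := by linarith
  have hr₃' := hκmul hr₃
  obtain ⟨r₄, hl₄, hu₄, hreg₄⟩ := exists_bohrRegular hd hΓ (half_pos hr₃'.1)
  have hr₄ : 0 < r₄ := by linarith
  have hr₄' := hκmul hr₄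
  have hb₁ : κ * r / 2 ≤ r₁ := hl₁
  have hb₂ : κ ^ 2 * r / 8 ≤ r₂ := by linarith [hκle hb₁]
  have hb₃ : κ ^ 3 * r / 32 ≤ r₃ := by linarith [hκle hb₂]
  have hb₄ : κ ^ 4 * r / 128 ≤ r₄ := by linarith [hκle hb₃]
  have hb₅ : κ ^ 5 / 256 * r ≤ κ * r₄ / 2 := by linarith [hκle hb₄]
  have hdd : d ≤ d + K * (l + 1) ^ 4 := Nat.le_add_right _ _
  have hdiff : ∀ {s : ℝ}, s ≤ κ * r → ∀ a ∈ A, ∀ y ∈ bohrSet Γ s,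
      a - y ∈ bohrSet Γ ((1 + κ) * r) := fun hs a ha y hy ↦
    bohrSet_mono (by linarith) (sub_mem_bohrSet (hA ha) hy)
  have hregr : (#(bohrSet Γ ((1 + κ) * r)) : ℝ) ≤ 1.01 * #(bohrSet Γ r) := by rw [hκ]; exact hreg
  have hreg₁' : (#(bohrSet Γ ((1 + κ) * r₁)) : ℝ) ≤ 1.01 * #(bohrSet Γ r₁) := by
    rw [hκ]; exact hreg₁
  have hreg₂' : (#(bohrSet Γ ((1 + κ) * r₂)) : ℝ) ≤ 1.01 * #(bohrSet Γ r₂) := by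
    rw [hκ]; exact hreg₂
  obtain ⟨x, hx | hx | ⟨hx₁, hx₂⟩⟩ := exists_translate_dense_or hα0.le hdens hregr
    ⟨0, zero_mem_bohrSet (by positivity)⟩ (hdiff hu₁) (hdiff (s := r₂) (by linarith))
    (card_bohrSet_pos hr₁.le) (card_bohrSet_pos hr₂.le)
  · exact ⟨Γ, r₁, _, hΓ.trans hdd, by linarith, by linarith, hreg₁.mono hr₁.le hd hdd,
      filter_subset _ _, hfree.translate_filter x, hx⟩
  · exact ⟨Γ, r₂, _, hΓ.trans hdd, by linarith, by linarith, hreg₂.mono hr₂.le hd hdd,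
      filter_subset _ _, hfree.translate_filter x, hx⟩
  set A₁ := {y ∈ bohrSet Γ r₁ | x + y ∈ A} with hA₁
  set A₂ := {y ∈ bohrSet Γ r₂ | x + y ∈ A} with hA₂
  have hdens' : ∀ {a b c : ℝ}, 0 ≤ b → c ≤ 1.01 * b → 0.97 * α * b ≤ a → c ≤ 2 ^ (l + 1) * a := by
    intro a b c hb hc ha
    have h3 : 2 ^ l * (0.97 * α * b) ≤ 2 ^ l * a := mul_le_mul_of_nonneg_left ha (by positivity)
    have h4 := mul_le_mul_of_nonneg_right hα hb
    rw [pow_succ]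
    linarith
  have hd₁ : #(bohrSet Γ ((1 + κ) * r₁)) ≤ 2 ^ (l + 1) * #A₁ := by
    exact_mod_cast hdens' (Nat.cast_nonneg _) hreg₁' hx₁
  have hd₂ : #(bohrSet Γ ((1 + κ) * r₂)) ≤ 2 ^ (l + 1) * #A₂ := by
    exact_mod_cast hdens' (Nat.cast_nonneg _) hreg₂' hx₂
  have hbig' : 8 * (2 ^ l) ^ 2 ≤ (#(bohrSet Γ r₁) : ℝ) :=
    hbig.trans (by exact_mod_cast card_le_card (bohrSet_mono hl₁))
  have hbig₁ : 4 * #(bohrSet Γ ((1 + κ) * r₁)) ≤ #A₁ ^ 2 := by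
    have : (4 * #(bohrSet Γ ((1 + κ) * r₁)) : ℝ) ≤ (#A₁ : ℝ) ^ 2 :=
      four_mul_le_sq_of_dense hα0.le (Nat.cast_nonneg _) hreg₁' hx₁ hbig' hα
    exact_mod_cast this
  obtain ⟨Γ', hΓ', hinc⟩ := exists_dense_translate_of_no_midpoints h2 hκ hr₂ hr₃ hr₄
    (by linarith) (by linarith) (by linarith) (by linarith) hreg₃ hreg₄
    (filter_subset _ _) (filter_subset _ _) (fun a ha b hb c hc h ↦ by
      rw [mem_filter] at ha hb hc
      refine add_left_cancel (hfree ha.2 hb.2 hc.2 (?_ : x + a + (x + c) = x + b + (x + b)))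
      rw [add_add_add_comm, h, add_add_add_comm]) hd₁ hd₂ hbig₁
  have hrank : #(Γ ∪ Γ') ≤ d + K * (l + 1) ^ 4 :=
    (card_union_le _ _).trans (add_le_add hΓ (hΓ'.trans (hK l)))
  obtain ⟨r₅, hl₅, hu₅, hreg₅⟩ := exists_bohrRegular (hd.trans hdd) hrank hr₄'.1
  obtain ⟨z, hz⟩ := hinc r₅ (by linarith) (by linarith) hu₅
  refine ⟨Γ ∪ Γ', r₅, _, hrank, by linarith, by linarith, hreg₅, filter_subset _ _,
    (hfree.translate_filter x).dilate_filter h2 z, le_trans ?_ hz⟩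
  refine mul_le_mul_of_nonneg_right ?_ (Nat.cast_nonneg _)
  have hB : (0 : ℝ) < #(bohrSet Γ ((1 + κ) * r₁)) := by
    exact_mod_cast card_bohrSet_pos (by positivity)
  rw [mul_div_assoc', le_div_iff₀ hB]
  have h3 := mul_le_mul_of_nonneg_left hreg₁' hα0.le
  have h4 : (0 : ℝ) ≤ α * #(bohrSet Γ r₁) := by positivity
  linarith

end Step

section Iterate

variable {G : Type*} [Fintype G] [AddCommGroup G]

lemma bohrSet_empty (r : ℝ) : bohrSet (∅ : Finset (AddChar G ℂ)) r = univ := by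
  simp [bohrSet]

lemma exists_iterated_increment (h2 : Function.Injective fun x : G ↦ x + x) {K : ℕ}
    (hK : ∀ l : ℕ, 15360000 * (15360001 * (1920017 * (l + 1) ^ 2 + 1) ^ 2 + 1) ≤ K * (l + 1) ^ 4)
    {l n D : ℕ} {q : ℝ} (hD : D = 1 + n * (K * (l + 1) ^ 4))
    (hq : q = (1 / (1000 * D)) ^ 5 / 256)
    (hbig : ∀ Γ : Finset (AddChar G ℂ), #Γ ≤ D →
      8 * (2 ^ l) ^ 2 ≤ (#(bohrSet Γ (q ^ (n + 1))) : ℝ))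
    {A : Finset G} (hfree : ThreeAPFree (A : Set G)) (hA : Fintype.card G ≤ 2 ^ l * #A)
    {i : ℕ} (hi : i ≤ n) :
    ∃ (Γ : Finset (AddChar G ℂ)) (r : ℝ) (A' : Finset G), #Γ ≤ 1 + i * (K * (l + 1) ^ 4) ∧
      q ^ i ≤ r ∧ r ≤ 2 ∧ BohrRegular (1 + i * (K * (l + 1) ^ 4)) Γ r ∧
      A' ⊆ bohrSet Γ r ∧ ThreeAPFree (A' : Set G) ∧
      1.01 ^ i * (1 / 2 ^ l) * #(bohrSet Γ r) ≤ (#A' : ℝ) := by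
  have hp : (0 : ℝ) < 2 ^ l := by positivity
  have hD1 : 1 ≤ D := by rw [hD]; exact Nat.le_add_right _ _
  have hD0 : (1 : ℝ) ≤ D := by exact_mod_cast hD1
  obtain ⟨κ, hκ⟩ : ∃ κ : ℝ, κ = 1 / (1000 * D) := ⟨_, rfl⟩
  have hκ0 : 0 < κ := by rw [hκ]; positivity
  have hκ1 : κ ≤ 1 := by
    rw [hκ, div_le_one (by positivity)]; linarith
  rw [← hκ] at hq
  have hq0 : 0 < q := by rw [hq]; positivity
  have hqκ : q ≤ κ / 2 := by
    rw [hq]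
    have := pow_le_of_le_one hκ0.le hκ1 (by norm_num : 5 ≠ 0)
    linarith
  obtain ⟨M, hM⟩ : ∃ M, M = K * (l + 1) ^ 4 := ⟨_, rfl⟩
  rw [← hM] at hD ⊢
  induction i with
  | zero =>
    refine ⟨∅, 1, A, by simp, by simp, by norm_num, ?_, by simp [bohrSet_empty], hfree, ?_⟩
    · rw [BohrRegular, bohrSet_empty, bohrSet_empty]
      have : (0 : ℝ) ≤ #(univ : Finset G) := Nat.cast_nonneg _
      linarith
    · rw [bohrSet_empty, pow_zero, one_mul, one_div_mul_eq_div, div_le_iff₀ hp, mul_comm, card_univ]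
      exact_mod_cast hA
  | succ i ih =>
    obtain ⟨Γ, r, A', hΓ, hqr, hr2, hreg, hA', hfree', hdens⟩ := ih (by omega)
    have hr : 0 < r := (pow_pos hq0 i).trans_le hqr
    have hiD : 1 + i * M ≤ D := by
      rw [hD]; exact Nat.add_le_add_left (Nat.mul_le_mul_right _ (by omega)) _
    obtain ⟨d, hd⟩ : ∃ d, d = 1 + i * M := ⟨_, rfl⟩
    have hsucc : 1 + (i + 1) * M = d + M := by rw [hd]; ring
    have hd1 : 1 ≤ d := by omega
    have hdD : (d : ℝ) ≤ D := by exact_mod_cast hd ▸ hiD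
    have hd0 : (1 : ℝ) ≤ d := by exact_mod_cast hd1
    rw [← hd] at hΓ hreg hiD
    rw [hsucc]
    have hκd : κ ≤ 1 / (1000 * d) := by
      rw [hκ]; exact one_div_le_one_div_of_le (by linarith) (by linarith)
    have hα : (1 : ℝ) ≤ 2 ^ l * (1.01 ^ i * (1 / 2 ^ l)) := by
      rw [mul_left_comm, mul_one_div_cancel hp.ne', mul_one]
      exact one_le_pow₀ (by norm_num)
    have hrad : q ^ (n + 1) ≤ 1 / (1000 * d) * r / 2 := by
      have h1 : q ^ (n + 1) ≤ q ^ (i + 1) :=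
        pow_le_pow_of_le_one hq0.le (by linarith) (by omega)
      have h3 : q ^ i * q ≤ r * (κ / 2) := mul_le_mul hqr hqκ hq0.le hr.le
      have h4 := mul_le_mul_of_nonneg_right hκd hr.le
      rw [pow_succ q i] at h1
      linarith
    obtain ⟨Γ', r', A'', hΓ', hr', hr2', hreg', hA'', hfree'', hdens'⟩ :=
      exists_density_increment h2 hK hd1 hΓ hr hr2 hreg hA' hfree' hdens hα
        ((hbig Γ (hΓ.trans hiD)).trans (by exact_mod_cast card_le_card (bohrSet_mono hrad)))
    rw [← hM] at hΓ' hreg'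
    refine ⟨Γ', r', A'', hΓ', le_trans ?_ hr', hr2', hreg', hA'', hfree'', le_trans ?_ hdens'⟩
    · rw [pow_succ, mul_comm]
      refine mul_le_mul ?_ hqr (by positivity) (by positivity)
      rw [hq]
      gcongr
    · exact mul_le_mul_of_nonneg_right (by rw [pow_succ]; linarith) (Nat.cast_nonneg _)

lemma two_pow_lt_pow {l : ℕ} (hl : 1 ≤ l) : (2 : ℝ) ^ l < 1.01 ^ (100 * l) := by
  rw [pow_mul]
  exact pow_lt_pow_left₀ (by norm_num) (by norm_num) (by omega)

lemma two_pow_mul_card_lt (h2 : Function.Injective fun x : G ↦ x + x) {K : ℕ}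
    (hK : ∀ l : ℕ, 15360000 * (15360001 * (1920017 * (l + 1) ^ 2 + 1) ^ 2 + 1) ≤ K * (l + 1) ^ 4)
    {l D k : ℕ} (hl : 1 ≤ l) (hD : D = 1 + 100 * l * (K * (l + 1) ^ 4))
    (hk : 2 / 2 ^ k ≤ ((1 / (1000 * D) : ℝ) ^ 5 / 256) ^ (100 * l + 1))
    (hG : 81 ^ (D * k) * (8 * (2 ^ l) ^ 2) ≤ Fintype.card G)
    {A : Finset G} (hfree : ThreeAPFree (A : Set G)) : 2 ^ l * #A < Fintype.card G := by
  by_contra! hA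
  obtain ⟨Γ, r, A', -, hr, -, -, hA', -, hdens⟩ := exists_iterated_increment h2 hK hD rfl
    (fun Γ hΓ ↦ by
      have h1 := hG.trans (card_le_card_bohrSet (Γ := Γ) k)
      have h3 : 81 ^ (#Γ * k) ≤ 81 ^ (D * k) :=
        Nat.pow_le_pow_right (by norm_num) (Nat.mul_le_mul_right _ hΓ)
      have h4 := Nat.le_of_mul_le_mul_left (h1.trans (Nat.mul_le_mul_right _ h3))
        (Nat.pos_of_ne_zero (pow_ne_zero _ (by norm_num)))
      exact_mod_cast h4.trans (card_le_card (bohrSet_mono hk))) hfree hA le_rfl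
  have hp : (0 : ℝ) < 2 ^ l := by positivity
  have hr0 : 0 ≤ r := le_trans (by positivity) hr
  have hB : (0 : ℝ) < #(bohrSet Γ r) := by exact_mod_cast card_bohrSet_pos hr0
  have hle : (#A' : ℝ) ≤ #(bohrSet Γ r) := by exact_mod_cast card_le_card hA'
  have h1 : 1 < 1.01 ^ (100 * l) * (1 / 2 ^ l : ℝ) := by
    rw [mul_one_div, lt_div_iff₀ hp, one_mul]; exact two_pow_lt_pow hl
  have := mul_lt_mul_of_pos_right h1 hB
  linarith

end Iterate

section Quantitative

/-- In a finite abelian group with injective doubling, progression-free sets of density `2⁻ˡ` force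
the group to have at most `2 ^ O(l⁶ log l)` elements. -/
lemma exists_two_pow_mul_card_lt :
    ∃ C : ℕ, 1 ≤ C ∧ ∀ (G : Type) [Fintype G] [AddCommGroup G],
      (Function.Injective fun x : G ↦ x + x) → ∀ l : ℕ, 1 ≤ l →
      2 ^ (C * (Nat.log 2 l + 1) * l ^ 6) ≤ Fintype.card G →
      ∀ A : Finset G, ThreeAPFree (A : Set G) → 2 ^ l * #A < Fintype.card G := by
  obtain ⟨K, hK1, hK⟩ : ∃ K : ℕ, 1 ≤ K ∧ ∀ l : ℕ,
      15360000 * (15360001 * (1920017 * (l + 1) ^ 2 + 1) ^ 2 + 1) ≤ K * (l + 1) ^ 4 := by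
    refine ⟨15360000 * (15360001 * 1920018 ^ 2 + 1), by norm_num, fun l ↦ ?_⟩
    have h1 : 1 ≤ (l + 1) ^ 2 := Nat.one_le_pow _ _ (by omega)
    have h2 : 1 ≤ (l + 1) ^ 4 := Nat.one_le_pow _ _ (by omega)
    have h3 : (1920017 * (l + 1) ^ 2 + 1) ^ 2 ≤ (1920018 * (l + 1) ^ 2) ^ 2 :=
      Nat.pow_le_pow_left (by omega) 2
    have h4 : (1920018 * (l + 1) ^ 2) ^ 2 = 1920018 ^ 2 * (l + 1) ^ 4 := by ring
    rw [h4] at h3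
    rw [mul_assoc]
    refine Nat.mul_le_mul_left _ ?_
    rw [add_mul, one_mul, mul_assoc]
    exact add_le_add (Nat.mul_le_mul_left _ h3) h2
  obtain ⟨K', hK'⟩ : ∃ K', K' = 1601 * K := ⟨_, rfl⟩
  obtain ⟨K'', hK''⟩ : ∃ K'', K'' = 83 + 5 * K' := ⟨_, rfl⟩
  refine ⟨714 * K' * K'' + 5, by omega, fun G _ _ h2 l hl hG A hA ↦ ?_⟩
  obtain ⟨u, hu⟩ : ∃ u, u = Nat.log 2 l + 1 := ⟨_, rfl⟩
  rw [← hu] at hG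
  have hu1 : 1 ≤ u := by omega
  have hlu : l ≤ 2 ^ u := by rw [hu]; exact (Nat.lt_pow_succ_log_self (by norm_num) l).le
  obtain ⟨D, hD⟩ : ∃ D, D = 1 + 100 * l * (K * (l + 1) ^ 4) := ⟨_, rfl⟩
  have hD1 : 1 ≤ D := by rw [hD]; exact Nat.le_add_right _ _
  have hDl : D ≤ K' * l ^ 5 := by
    have h3 : (l + 1) ^ 4 ≤ (2 * l) ^ 4 := Nat.pow_le_pow_left (by omega) 4
    have h4 : 1 ≤ K * l ^ 5 := Nat.mul_pos hK1 (Nat.pow_pos hl)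
    calc D ≤ 1 + 100 * l * (K * (2 * l) ^ 4) := by
          rw [hD]; gcongr
      _ = 1 + 1600 * (K * l ^ 5) := by ring
      _ ≤ 1601 * (K * l ^ 5) := by omega
      _ = K' * l ^ 5 := by rw [hK']; ring
  have hDu : D ≤ 2 ^ (K' + 5 * u) := by
    refine hDl.trans ?_
    rw [pow_add, mul_comm 5, pow_mul]
    exact Nat.mul_le_mul Nat.lt_two_pow_self.le (Nat.pow_le_pow_left hlu 5)
  obtain ⟨k, hk⟩ : ∃ k, k = K'' * u * (100 * l + 1) + 1 := ⟨_, rfl⟩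
  have hkl : k ≤ 102 * K'' * u * l := by
    have h3 : 1 ≤ K'' * u * l := Nat.mul_pos (Nat.mul_pos (by omega) hu1) hl
    have h4 : K'' * u ≤ K'' * u * l := Nat.le_mul_of_pos_right _ hl
    calc k = 100 * (K'' * u * l) + K'' * u + 1 := by rw [hk]; ring
      _ ≤ 102 * (K'' * u * l) := by omega
      _ = _ := by ring
  refine two_pow_mul_card_lt h2 hK hl hD (k := k) ?_ (le_trans ?_ hG) hA
  · have hDu' : (D : ℝ) ≤ 2 ^ (K' + 5 * u) := by exact_mod_cast hDu
    have hD0 : (0 : ℝ) < D := by exact_mod_cast hD1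
    have h3 : (2 : ℝ) / 2 ^ k = (1 / 2 ^ (K'' * u)) ^ (100 * l + 1) := by
      rw [hk, pow_succ, one_div_pow, ← pow_mul]
      field_simp
    rw [h3]
    refine pow_le_pow_left₀ (by positivity) ?_ _
    rw [one_div_pow, div_div]
    refine one_div_le_one_div_of_le (by positivity) ?_
    calc (1000 * (D : ℝ)) ^ 5 * 256 ≤ (2 ^ 10 * 2 ^ (K' + 5 * u)) ^ 5 * 2 ^ 8 := by
          gcongr <;> norm_num
      _ = 2 ^ (58 + 5 * K' + 25 * u) := by
          rw [← pow_add, ← pow_mul, ← pow_add]; congr 1; ring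
      _ ≤ 2 ^ (K'' * u) := by
          refine pow_le_pow_right₀ (by norm_num) ?_
          rw [hK'']
          nlinarith
  · have hDk : D * k ≤ 102 * K' * K'' * (u * l ^ 6) := by
      calc D * k ≤ K' * l ^ 5 * (102 * K'' * u * l) := Nat.mul_le_mul hDl hkl
        _ = _ := by ring
    have h3 : l ≤ u * l ^ 6 := by
      calc l ≤ l ^ 6 := Nat.le_self_pow (by norm_num) l
        _ ≤ _ := Nat.le_mul_of_pos_left _ hu1
    have h4 : (714 * K' * K'' + 5) * u * l ^ 6 = 7 * (102 * K' * K'' * (u * l ^ 6)) +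
        5 * (u * l ^ 6) := by ring
    rw [h4]
    calc 81 ^ (D * k) * (8 * (2 ^ l) ^ 2) ≤ (2 ^ 7) ^ (D * k) * (2 ^ 3 * (2 ^ l) ^ 2) := by
          gcongr <;> norm_num
      _ = 2 ^ (7 * (D * k) + (3 + l * 2)) := by
          rw [← pow_mul, ← pow_mul, ← pow_add, ← pow_add]
      _ ≤ _ := Nat.pow_le_pow_right (by norm_num) (by omega)

end Quantitative

section Integers

lemma ZMod.injective_add_self_two_mul_add_one (N : ℕ) :
    Function.Injective fun x : ZMod (2 * N + 1) ↦ x + x := by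
  have key : ∀ x : ZMod (2 * N + 1), ((N : ZMod (2 * N + 1)) + 1) * (x + x) = x := by
    intro x
    have h : ((2 * N + 1 : ℕ) : ZMod (2 * N + 1)) = 0 := ZMod.natCast_self _
    push_cast at h
    linear_combination x * h
  intro x y hxy
  have hxy' : x + x = y + y := hxy
  rw [← key x, hxy', key y]

lemma eq_of_intCast_zmod_eq {N : ℕ} {x y : ℤ} (h : (x : ZMod (2 * N + 1)) = y)
    (hxy : |x - y| ≤ 2 * N) : x = y := by
  have h1 : ((2 * N + 1 : ℕ) : ℤ) ∣ x - y := (ZMod.intCast_eq_intCast_iff_dvd_sub y x _).1 h.symm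
  have := Int.eq_zero_of_abs_lt_dvd h1 (by push_cast; omega)
  omega

lemma card_image_intCast_zmod {N : ℕ} {A : Finset ℤ} (hA : A ⊆ Icc (1 : ℤ) N) :
    #(A.image (Int.cast : ℤ → ZMod (2 * N + 1))) = #A := by
  refine card_image_of_injOn fun x hx y hy hxy ↦ eq_of_intCast_zmod_eq hxy ?_
  have h1 := mem_Icc.1 (hA hx)
  have h2 := mem_Icc.1 (hA hy)
  rw [abs_le]; omega

lemma threeAPFree_image_intCast_zmod {N : ℕ} {A : Finset ℤ} (hA : A ⊆ Icc (1 : ℤ) N)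
    (hfree : ∀ a d : ℤ, d ≠ 0 → ¬(a ∈ A ∧ a + d ∈ A ∧ a + 2 * d ∈ A)) :
    ThreeAPFree ((A.image (Int.cast : ℤ → ZMod (2 * N + 1)) : Finset _) :
      Set (ZMod (2 * N + 1))) := by
  intro a' ha' b' hb' c' hc' h
  obtain ⟨a, ha, rfl⟩ := mem_image.1 (mem_coe.1 ha')
  obtain ⟨b, hb, rfl⟩ := mem_image.1 (mem_coe.1 hb')
  obtain ⟨c, hc, rfl⟩ := mem_image.1 (mem_coe.1 hc')
  have h1 := mem_Icc.1 (hA ha)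
  have h2 := mem_Icc.1 (hA hb)
  have h3 := mem_Icc.1 (hA hc)
  have h4 : a + c = b + b :=
    eq_of_intCast_zmod_eq (N := N) (by push_cast; exact h) (by rw [abs_le]; omega)
  by_contra hne
  refine hfree a (b - a) (fun h0 ↦ hne ?_) ⟨ha, ?_, ?_⟩
  · rw [sub_eq_zero.1 h0]
  · rwa [add_sub_cancel]
  · rwa [show a + 2 * (b - a) = c by omega]

end Integers

section Asymptotics

lemma exists_le_rpow_div_log (X : ℝ) :
    ∃ L₀ : ℝ, ∀ L, L₀ ≤ L → 1 ≤ L ∧ 1 ≤ Real.log L ∧ X ≤ (L / Real.log L) ^ ((1 : ℝ) / 6) := by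
  have h1 : Filter.Tendsto (fun L : ℝ ↦ L / Real.log L) Filter.atTop Filter.atTop := by
    have h := Real.isLittleO_log_id_atTop.tendsto_div_nhds_zero
    have h' : Filter.Tendsto (fun L : ℝ ↦ Real.log L / L) Filter.atTop (nhdsWithin 0 (Set.Ioi 0)) :=
      tendsto_nhdsWithin_iff.2 ⟨h, by
        filter_upwards [Filter.eventually_gt_atTop 1] with L hL
        exact div_pos (Real.log_pos hL) (by linarith)⟩
    refine h'.inv_tendsto_nhdsGT_zero.congr fun L ↦ ?_
    simp
  have h2 := (tendsto_rpow_atTop (by norm_num : (0 : ℝ) < 1 / 6)).comp h1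
  have h3 := (h2.eventually_ge_atTop X).and ((Filter.eventually_ge_atTop (1 : ℝ)).and
    (Real.tendsto_log_atTop.eventually_ge_atTop 1))
  obtain ⟨L₀, hL₀⟩ := Filter.eventually_atTop.1 h3
  exact ⟨L₀, fun L hL ↦ ⟨(hL₀ L hL).2.1, (hL₀ L hL).2.2, (hL₀ L hL).1⟩⟩

lemma natLog_two_add_one_le {l : ℕ} {L : ℝ} (hl : 1 ≤ l) (hL : (l : ℝ) ≤ L)
    (hL1 : 1 ≤ Real.log L) : ((Nat.log 2 l + 1 : ℕ) : ℝ) ≤ 3 * Real.log L := by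
  have hl0 : (0 : ℝ) < l := by exact_mod_cast hl
  have h1 : ((2 : ℝ) ^ Nat.log 2 l) ≤ l := by exact_mod_cast Nat.pow_log_le_self 2 (by omega)
  have h2 := Real.log_le_log (by positivity) (h1.trans hL)
  rw [Real.log_pow] at h2
  have h3 := Real.log_two_gt_d9
  have h4 : (0 : ℝ) ≤ Nat.log 2 l := Nat.cast_nonneg _
  push_cast
  nlinarith

end Asymptotics

end ThreeTermProgressions

/-- There exist absolute constants `c > 0` and `N₀` such that for every
integer `N ≥ N₀`: if `A ⊆ {1, …, N}` contains no nontrivial three-term arithmetic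
progression, then `|A| ≤ exp(−c (log N)^{1/6} (log log N)^{−1/6}) · N`. -/
theorem statement0 :
    ∃ c : ℝ, 0 < c ∧ ∃ N₀ : ℕ, ∀ N : ℕ, N₀ ≤ N →
      ∀ A : Finset ℤ, A ⊆ Finset.Icc (1 : ℤ) N →
        (∀ a d : ℤ, d ≠ 0 → ¬(a ∈ A ∧ a + d ∈ A ∧ a + 2 * d ∈ A)) →
        (A.card : ℝ) ≤
          Real.exp (-c * Real.log N ^ ((1 : ℝ) / 6) *
            Real.log (Real.log N) ^ (-(1 : ℝ) / 6)) * N := by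
  obtain ⟨C, hC, hmain⟩ := exists_two_pow_mul_card_lt
  have hC0 : (1 : ℝ) ≤ C := by exact_mod_cast hC
  obtain ⟨c₀, hc₀⟩ : ∃ c₀ : ℝ, c₀ = 1 / (3 * C) := ⟨_, rfl⟩
  have hc₀0 : 0 < c₀ := by rw [hc₀]; positivity
  have hc₀1 : c₀ ≤ 1 := by rw [hc₀, div_le_one (by positivity)]; linarith
  obtain ⟨L₀, hL₀⟩ := exists_le_rpow_div_log (20 / c₀)
  refine ⟨c₀ / 2, by positivity, ⌈Real.exp L₀⌉₊ + 1, fun N hN A hA hfree ↦ ?_⟩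
  have hN1 : (1 : ℝ) ≤ N := by exact_mod_cast (by omega : 1 ≤ N)
  have hN0 : (0 : ℝ) < N := by linarith
  obtain ⟨L, hL⟩ : ∃ L, L = Real.log N := ⟨_, rfl⟩
  have hexpL : Real.exp L = N := by rw [hL, Real.exp_log hN0]
  have hLL₀ : L₀ ≤ L := by
    rw [hL, Real.le_log_iff_exp_le hN0]
    exact (Nat.le_ceil _).trans (by exact_mod_cast (by omega : ⌈Real.exp L₀⌉₊ ≤ N))
  obtain ⟨hL1, hLL1, hx⟩ := hL₀ L hLL₀
  rw [← hL]
  have hL0 : 0 < L := by linarith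
  have hLL0 : 0 < Real.log L := by linarith
  obtain ⟨x, hxd⟩ : ∃ x, x = (L / Real.log L) ^ ((1 : ℝ) / 6) := ⟨_, rfl⟩
  have hgoal : -(c₀ / 2) * L ^ ((1 : ℝ) / 6) * Real.log L ^ (-(1 : ℝ) / 6) = -(c₀ / 2) * x := by
    rw [hxd, Real.div_rpow hL0.le hLL0.le, neg_div, Real.rpow_neg hLL0.le, mul_assoc,
      div_eq_mul_inv (L ^ ((1 : ℝ) / 6))]
  rw [hgoal]
  rw [← hxd, div_le_iff₀ hc₀0] at hx
  have hx0 : 0 < x := by rw [hxd]; positivity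
  have hx6 : x ^ 6 = L / Real.log L := by
    rw [hxd, ← Real.rpow_natCast, ← Real.rpow_mul (by positivity)]; norm_num
  have hxL : x ≤ L := by
    have h1 : L / Real.log L ≤ L := div_le_self hL0.le hLL1
    calc x ≤ L ^ ((1 : ℝ) / 6) := by
          rw [hxd]
          exact Real.rpow_le_rpow (by positivity) h1 (by norm_num)
      _ ≤ L ^ (1 : ℝ) := Real.rpow_le_rpow_of_exponent_le hL1 (by norm_num)
      _ = L := Real.rpow_one L
  have hcx0 : 0 ≤ x * c₀ := by positivity
  obtain ⟨l, hl⟩ : ∃ l, l = ⌊x * c₀⌋₊ := ⟨_, rfl⟩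
  have hlx : (l : ℝ) ≤ x * c₀ := by rw [hl]; exact Nat.floor_le hcx0
  have hxl : x * c₀ < l + 1 := by rw [hl]; exact Nat.lt_floor_add_one _
  have hl1 : 1 ≤ l := by
    rw [hl, Nat.one_le_floor_iff]; linarith
  have hlL : (l : ℝ) ≤ L := hlx.trans ((mul_le_of_le_one_right hx0.le hc₀1).trans hxL)
  have hexpo : ((C * (Nat.log 2 l + 1) * l ^ 6 : ℕ) : ℝ) ≤ L := by
    have h1 := natLog_two_add_one_le hl1 hlL hLL1
    have h2 : (l : ℝ) ^ 6 ≤ x ^ 6 * c₀ := by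
      calc (l : ℝ) ^ 6 ≤ (x * c₀) ^ 6 := pow_le_pow_left₀ (Nat.cast_nonneg _) hlx 6
        _ = x ^ 6 * c₀ ^ 6 := mul_pow _ _ _
        _ ≤ x ^ 6 * c₀ := by
          gcongr
          exact pow_le_of_le_one hc₀0.le hc₀1 (by norm_num)
    rw [hx6] at h2
    calc ((C * (Nat.log 2 l + 1) * l ^ 6 : ℕ) : ℝ)
        = C * ((Nat.log 2 l + 1 : ℕ) : ℝ) * (l : ℝ) ^ 6 := by push_cast; ring
      _ ≤ C * (3 * Real.log L) * (L / Real.log L * c₀) := by gcongr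
      _ = L := by rw [hc₀]; field_simp
  have hpow : 2 ^ (C * (Nat.log 2 l + 1) * l ^ 6) ≤ Fintype.card (ZMod (2 * N + 1)) := by
    rw [ZMod.card]
    obtain ⟨e, he⟩ : ∃ e, e = C * (Nat.log 2 l + 1) * l ^ 6 := ⟨_, rfl⟩
    rw [← he] at hexpo ⊢
    have h1 : (2 : ℝ) ^ e ≤ N := by
      rw [← hexpL]
      calc (2 : ℝ) ^ e ≤ Real.exp 1 ^ e :=
            pow_le_pow_left₀ (by norm_num) (by linarith [Real.add_one_le_exp (1 : ℝ)]) e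
        _ = Real.exp e := by rw [← Real.exp_nat_mul, mul_one]
        _ ≤ Real.exp L := Real.exp_le_exp.2 hexpo
    have h2 : 2 ^ e ≤ N := by exact_mod_cast h1
    omega
  have hlt := hmain (ZMod (2 * N + 1)) (ZMod.injective_add_self_two_mul_add_one N) l hl1 hpow _
    (threeAPFree_image_intCast_zmod hA hfree)
  rw [card_image_intCast_zmod hA, ZMod.card] at hlt
  have hlt' : (2 : ℝ) ^ l * A.card ≤ 3 * N := by
    have : 2 ^ l * A.card ≤ 3 * N := by omega
    exact_mod_cast this
  have h3 : (3 : ℝ) ≤ Real.exp 2 := by linarith [Real.add_one_le_exp (2 : ℝ)]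
  have h2l : (2 : ℝ) ^ l = Real.exp (l * Real.log 2) := by
    rw [Real.exp_nat_mul, Real.exp_log (by norm_num)]
  have h4 : Real.exp 2 ≤ 2 ^ l * Real.exp (-(c₀ / 2) * x) := by
    rw [h2l, ← Real.exp_add]
    refine Real.exp_le_exp.2 ?_
    have h5 := Real.log_two_gt_d9
    have h6 : (x * c₀ - 1) * 0.69 ≤ l * Real.log 2 :=
      mul_le_mul (by linarith) (by linarith) (by norm_num) (Nat.cast_nonneg _)
    linarith
  have hp : (0 : ℝ) < 2 ^ l := by positivity
  refine le_of_mul_le_mul_left (hlt'.trans ?_) hp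
  rw [← mul_assoc]
  exact mul_le_mul_of_nonneg_right (h3.trans h4) hN0.le
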